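/- Fix integers m ≥ 2, k ≥ 1 and n ≥ 1, set p = 2(m+k)/(m+k−2), and let λ > 0 be a real number with 2n(2n+m−1) < λ(p−2) ≤ (2n+2)(2n+2+m−1). Then there exists a finite set S of positive real numbers with at least 2n+2 elements such that: (i) for every α ∈ S there exists a solution u of the Yamabe ODE with u(0) = α, u'(0) = 0, u(t) > 0 for all t ∈ [0,π], and u'(π) = 0; and (ii) there are at least 2n+1 elements α ∈ S for which such a solution u can moreover be chosen with u'(π/2) = 0. -/

import Mathlib

open Real Set

/-- `u` is a solution of the Yamabe ODE
`u'' + (m-1) (cos t / sin t) u' + λ (u^(p-1) - u) = 0` on `(0, π)`,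
where `u^(p-1)` denotes the real power. -/
def IsYamabeSolution (m : ℕ) (p lam : ℝ) (u : ℝ → ℝ) : Prop :=
  ContinuousOn u (Set.Icc 0 π) ∧
  (∀ t ∈ Set.Icc (0 : ℝ) π, DifferentiableAt ℝ u t) ∧
  (∀ t ∈ Set.Ioo (0 : ℝ) π, DifferentiableAt ℝ (deriv u) t) ∧
  ∀ t ∈ Set.Ioo (0 : ℝ) π,
    deriv (deriv u) t + ((m : ℝ) - 1) * (Real.cos t / Real.sin t) * deriv u t
      + lam * (u t ^ (p - 1) - u t) = 0

/-! ### Monotonicity on closed intervals from derivatives in the interior -/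

theorem monotoneOn_Icc_of_hasDerivAt {f f' : ℝ → ℝ} {a b : ℝ} (hf : ContinuousOn f (Icc a b))
    (hd : ∀ t ∈ Ioo a b, HasDerivAt f (f' t) t) (hn : ∀ t ∈ Ioo a b, 0 ≤ f' t) :
    MonotoneOn f (Icc a b) := by
  refine monotoneOn_of_hasDerivWithinAt_nonneg (f' := f') (convex_Icc a b) hf ?_ ?_
  · intro x hx
    rw [interior_Icc] at hx
    exact (hd x hx).hasDerivWithinAt
  · intro x hx
    rw [interior_Icc] at hx
    exact hn x hx

theorem antitoneOn_Icc_of_hasDerivAt {f f' : ℝ → ℝ} {a b : ℝ} (hf : ContinuousOn f (Icc a b))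
    (hd : ∀ t ∈ Ioo a b, HasDerivAt f (f' t) t) (hn : ∀ t ∈ Ioo a b, f' t ≤ 0) :
    AntitoneOn f (Icc a b) := by
  have := monotoneOn_Icc_of_hasDerivAt (f := fun t => -f t) (f' := fun t => -f' t) hf.neg
    (fun t ht => (hd t ht).neg) (fun t ht => by have := hn t ht; linarith)
  intro x hx y hy hxy
  have := this hx hy hxy
  simp only at this
  linarith

theorem strictMonoOn_Icc_of_hasDerivAt {f f' : ℝ → ℝ} {a b : ℝ} (hf : ContinuousOn f (Icc a b))
    (hd : ∀ t ∈ Ioo a b, HasDerivAt f (f' t) t) (hn : ∀ t ∈ Ioo a b, 0 < f' t) :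
    StrictMonoOn f (Icc a b) := by
  refine strictMonoOn_of_deriv_pos (convex_Icc a b) hf ?_
  intro x hx
  rw [interior_Icc] at hx
  rw [(hd x hx).deriv]
  exact hn x hx

theorem strictAntiOn_Icc_of_hasDerivAt {f f' : ℝ → ℝ} {a b : ℝ} (hf : ContinuousOn f (Icc a b))
    (hd : ∀ t ∈ Ioo a b, HasDerivAt f (f' t) t) (hn : ∀ t ∈ Ioo a b, f' t < 0) :
    StrictAntiOn f (Icc a b) := by
  refine strictAntiOn_of_deriv_neg (convex_Icc a b) hf ?_
  intro x hx
  rw [interior_Icc] at hx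
  rw [(hd x hx).deriv]
  exact hn x hx

theorem abs_sub_le_sub_of_hasDerivAt {g g' ψ ψ' : ℝ → ℝ} {a b : ℝ} (hab : a ≤ b)
    (hg : ContinuousOn g (Icc a b)) (hψ : ContinuousOn ψ (Icc a b))
    (hg' : ∀ t ∈ Ioo a b, HasDerivAt g (g' t) t) (hψ' : ∀ t ∈ Ioo a b, HasDerivAt ψ (ψ' t) t)
    (hle : ∀ t ∈ Ioo a b, |g' t| ≤ ψ' t) : |g b - g a| ≤ ψ b - ψ a := by
  have h1 := monotoneOn_Icc_of_hasDerivAt (hψ.sub hg) (fun t ht => (hψ' t ht).sub (hg' t ht))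
    (fun t ht => by have := abs_le.1 (hle t ht); linarith) (left_mem_Icc.2 hab)
    (right_mem_Icc.2 hab) hab
  have h2 := monotoneOn_Icc_of_hasDerivAt (hψ.add hg) (fun t ht => (hψ' t ht).add (hg' t ht))
    (fun t ht => by have := abs_le.1 (hle t ht); linarith) (left_mem_Icc.2 hab)
    (right_mem_Icc.2 hab) hab
  simp only [Pi.add_apply, Pi.sub_apply] at h1 h2
  rw [abs_le]
  constructor <;> linarith

/-! ### The radial operator on a hemisphere -/

/-- `v` is the flux `sin^d · u'` of a solution of `(sin^d · u')' = - sin^d · h` on `(0, π/2)`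
that is regular at the pole. -/
structure IsRadialFlux (d : ℕ) (h v : ℝ → ℝ) : Prop where
  v_cont : ContinuousOn v (Icc 0 (π / 2))
  v_zero : v 0 = 0
  v_deriv : ∀ t ∈ Ioo 0 (π / 2), HasDerivAt v (-(sin t ^ d * h t)) t

/-- `u` solves `(sin^d · u')' = - sin^d · h` on `(0, π/2)` with `v = sin^d · u'` vanishing at
the pole. -/
structure IsRadialSol (d : ℕ) (h u v : ℝ → ℝ) : Prop extends IsRadialFlux d h v where
  u_cont : ContinuousOn u (Icc 0 (π / 2))
  u_deriv : ∀ t ∈ Ioo 0 (π / 2), HasDerivAt u (v t / sin t ^ d) t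

theorem sin_pos_of_mem_hemisphere {t : ℝ} (ht : t ∈ Ioc 0 (π / 2)) : 0 < sin t :=
  sin_pos_of_pos_of_lt_pi ht.1 (by have := ht.2; linarith [pi_pos])

theorem cos_nonneg_of_mem_hemisphere {t : ℝ} (ht : t ∈ Icc 0 (π / 2)) : 0 ≤ cos t :=
  cos_nonneg_of_mem_Icc ⟨by linarith [ht.1, pi_pos], ht.2⟩

theorem sin_nonneg_of_mem_hemisphere {t : ℝ} (ht : t ∈ Icc 0 (π / 2)) : 0 ≤ sin t :=
  sin_nonneg_of_nonneg_of_le_pi ht.1 (by have := ht.2; linarith [pi_pos])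

theorem sin_le_sin_of_hemisphere {q t : ℝ} (hq : 0 ≤ q) (hqt : q ≤ t) (ht : t ≤ π / 2) :
    sin q ≤ sin t :=
  sin_le_sin_of_le_of_le_pi_div_two (by linarith [pi_pos]) ht hqt

namespace IsRadialFlux

variable {d : ℕ} {h v : ℝ → ℝ}

theorem abs_v_le (H : IsRadialFlux d h v) {ψ ψ' : ℝ → ℝ} (hψ : ∀ t, HasDerivAt ψ (ψ' t) t)
    (hh : ∀ t ∈ Ioo 0 (π / 2), |h t| ≤ ψ' t) {t : ℝ} (ht : t ∈ Icc 0 (π / 2)) :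
    |v t| ≤ sin t ^ d * (ψ t - ψ 0) := by
  have hsub : Icc 0 t ⊆ Icc 0 (π / 2) := Icc_subset_Icc_right ht.2
  have hsub' : Ioo 0 t ⊆ Ioo 0 (π / 2) := Ioo_subset_Ioo_right ht.2
  have hcont : Continuous ψ := continuous_iff_continuousAt.2 fun t => (hψ t).continuousAt
  have := abs_sub_le_sub_of_hasDerivAt (g := v) (g' := fun t => -(sin t ^ d * h t))
    (ψ := fun q => sin t ^ d * ψ q) (ψ' := fun q => sin t ^ d * ψ' q) ht.1
    (H.v_cont.mono hsub) (continuous_const.mul hcont).continuousOn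
    (fun q hq => H.v_deriv q (hsub' hq)) (fun q _ => (hψ q).const_mul _)
    (fun q hq => by
      have hq' := hsub' hq
      have h0 : 0 ≤ sin q := sin_nonneg_of_mem_hemisphere (Ioo_subset_Icc_self hq')
      rw [abs_neg, abs_mul, abs_of_nonneg (pow_nonneg h0 d)]
      exact mul_le_mul (pow_le_pow_left₀ h0 (sin_le_sin_of_hemisphere hq.1.le hq.2.le ht.2) d)
        (hh q hq') (abs_nonneg _)
        (pow_nonneg (sin_nonneg_of_mem_hemisphere ht) d))
  rw [H.v_zero] at this
  simp only [sub_zero] at this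
  linarith

theorem abs_v_le_mul (H : IsRadialFlux d h v) {C : ℝ} (hh : ∀ t ∈ Ioo 0 (π / 2), |h t| ≤ C)
    {t : ℝ} (ht : t ∈ Icc 0 (π / 2)) : |v t| ≤ sin t ^ d * (C * t) := by
  have := H.abs_v_le (ψ := fun t => C * t) (ψ' := fun _ => C)
    (fun t => by simpa using (hasDerivAt_id t).const_mul C) hh ht
  simpa using this

theorem continuousOn_deriv (H : IsRadialFlux d h v) {C : ℝ} (hd : d ≠ 0)
    (hh : ∀ t ∈ Ioo 0 (π / 2), |h t| ≤ C) :
    ContinuousOn (fun t => v t / sin t ^ d) (Icc 0 (π / 2)) := by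
  intro t ht
  rcases eq_or_lt_of_le ht.1 with h0 | h0
  · subst h0
    rw [ContinuousWithinAt, sin_zero, zero_pow hd, div_zero]
    have hlim : Filter.Tendsto (fun t : ℝ => C * t) (nhdsWithin 0 (Icc 0 (π / 2))) (nhds 0) := by
      have : Continuous fun t : ℝ => C * t := by fun_prop
      simpa using (this.tendsto 0).mono_left nhdsWithin_le_nhds
    refine squeeze_zero_norm' ?_ hlim
    filter_upwards [self_mem_nhdsWithin] with t ht
    rcases eq_or_lt_of_le ht.1 with h0 | h0
    · simp [← h0, H.v_zero]
    · have hs : 0 < sin t ^ d := pow_pos (sin_pos_of_mem_hemisphere ⟨h0, ht.2⟩) d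
      rw [norm_eq_abs, abs_div, abs_of_pos hs, div_le_iff₀ hs, mul_comm]
      exact H.abs_v_le_mul hh ht
  · exact (H.v_cont t ht).div (Continuous.continuousWithinAt (by fun_prop))
      (pow_pos (sin_pos_of_mem_hemisphere ⟨h0, ht.2⟩) d).ne'

end IsRadialFlux

namespace IsRadialSol

variable {d : ℕ} {h u v : ℝ → ℝ}

theorem congr {h' : ℝ → ℝ} (H : IsRadialSol d h u v)
    (hh : ∀ t ∈ Ioo 0 (π / 2), h' t = h t) : IsRadialSol d h' u v :=
  ⟨⟨H.v_cont, H.v_zero, fun t ht => by rw [hh t ht]; exact H.v_deriv t ht⟩, H.u_cont, H.u_deriv⟩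

theorem sub {h' u' v' : ℝ → ℝ} (H : IsRadialSol d h u v) (H' : IsRadialSol d h' u' v') :
    IsRadialSol d (fun t => h t - h' t) (fun t => u t - u' t) (fun t => v t - v' t) :=
  ⟨⟨H.v_cont.sub H'.v_cont, by simp [H.v_zero, H'.v_zero],
    fun t ht => ((H.v_deriv t ht).sub (H'.v_deriv t ht)).congr_deriv (by ring)⟩,
    H.u_cont.sub H'.u_cont,
    fun t ht => ((H.u_deriv t ht).sub (H'.u_deriv t ht)).congr_deriv (by ring)⟩

theorem affine (H : IsRadialSol d h u v) (a b : ℝ) :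
    IsRadialSol d (fun t => a * h t) (fun t => a * u t + b) (fun t => a * v t) :=
  ⟨⟨H.v_cont.const_mul a, by simp [H.v_zero],
    fun t ht => ((H.v_deriv t ht).const_mul a).congr_deriv (by ring)⟩,
    (H.u_cont.const_mul a).add continuousOn_const,
    fun t ht => (((H.u_deriv t ht).const_mul a).add_const b).congr_deriv (by ring)⟩

theorem const (d : ℕ) (a : ℝ) : IsRadialSol d (fun _ => 0) (fun _ => a) (fun _ => 0) :=
  ⟨⟨continuousOn_const, rfl, fun t _ => by simpa using hasDerivAt_const t (0 : ℝ)⟩,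
    continuousOn_const, fun t _ => by simpa using hasDerivAt_const t a⟩

theorem abs_u_sub_le (H : IsRadialSol d h u v) {φ ψ ψ' : ℝ → ℝ}
    (hψ : ∀ t, HasDerivAt ψ (ψ' t) t) (hφ : ∀ t, HasDerivAt φ (ψ t - ψ 0) t)
    (hh : ∀ t ∈ Ioo 0 (π / 2), |h t| ≤ ψ' t) {t : ℝ} (ht : t ∈ Icc 0 (π / 2)) :
    |u t - u 0| ≤ φ t - φ 0 := by
  have hsub : Icc 0 t ⊆ Icc 0 (π / 2) := Icc_subset_Icc_right ht.2
  have hsub' : Ioo 0 t ⊆ Ioo 0 (π / 2) := Ioo_subset_Ioo_right ht.2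
  have hcont : Continuous φ := continuous_iff_continuousAt.2 fun t => (hφ t).continuousAt
  refine abs_sub_le_sub_of_hasDerivAt ht.1 (H.u_cont.mono hsub) hcont.continuousOn
    (fun q hq => H.u_deriv q (hsub' hq)) (fun q _ => hφ q) (fun q hq => ?_)
  have hq' := hsub' hq
  have h0 : 0 < sin q ^ d := pow_pos (sin_pos_of_mem_hemisphere (Ioo_subset_Ioc_self hq')) d
  rw [abs_div, abs_of_pos h0, div_le_iff₀ h0, mul_comm]
  exact H.abs_v_le hψ hh (Ioo_subset_Icc_self hq')

theorem abs_u_sub_le_sq (H : IsRadialSol d h u v) {C : ℝ} (hh : ∀ t ∈ Ioo 0 (π / 2), |h t| ≤ C)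
    {t : ℝ} (ht : t ∈ Icc 0 (π / 2)) : |u t - u 0| ≤ C * t ^ 2 / 2 := by
  have := H.abs_u_sub_le (φ := fun t => C * t ^ 2 / 2) (ψ := fun t => C * t) (ψ' := fun _ => C)
    (fun t => by simpa using (hasDerivAt_id t).const_mul C)
    (fun t => by
      have := (((hasDerivAt_id t).pow 2).const_mul C).div_const 2
      refine this.congr_deriv ?_
      simp; ring) hh ht
  simpa using this

theorem abs_v_le_exp (H : IsRadialSol d h u v) {C K : ℝ} (hC : 0 ≤ C) (hK : 0 < K)
    (hh : ∀ t ∈ Ioo 0 (π / 2), |h t| ≤ C * exp (K * t)) {t : ℝ} (ht : t ∈ Icc 0 (π / 2)) :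
    |v t| ≤ C * exp (K * t) / K := by
  have h1 := H.abs_v_le (ψ := fun t => C * exp (K * t) / K) (ψ' := fun t => C * exp (K * t))
    (fun t => by
      have := ((((hasDerivAt_id t).const_mul K).exp).const_mul C).div_const K
      refine this.congr_deriv ?_
      simp; field_simp) hh ht
  have h2 : sin t ^ d ≤ 1 :=
    pow_le_one₀ (sin_nonneg_of_mem_hemisphere ht) (sin_le_one t)
  have h4 : (1 : ℝ) ≤ exp (K * t) := one_le_exp (mul_nonneg hK.le ht.1)
  have h3 : 0 ≤ C * exp (K * t) / K - C * exp (K * 0) / K := by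
    rw [← sub_div]
    refine div_nonneg ?_ hK.le
    simp only [mul_zero, exp_zero, mul_one]
    nlinarith
  have h5 : 0 ≤ C * exp (K * 0) / K := by positivity
  have h6 := mul_le_of_le_one_left h3 h2
  linarith

theorem abs_u_sub_le_exp (H : IsRadialSol d h u v) {C K : ℝ} (hC : 0 ≤ C) (hK : 0 < K)
    (hh : ∀ t ∈ Ioo 0 (π / 2), |h t| ≤ C * exp (K * t)) {t : ℝ} (ht : t ∈ Icc 0 (π / 2)) :
    |u t - u 0| ≤ C * exp (K * t) / K ^ 2 := by
  have h1 := H.abs_u_sub_le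
    (φ := fun t => C * exp (K * t) / K ^ 2 - C * exp (K * 0) / K * t)
    (ψ := fun t => C * exp (K * t) / K) (ψ' := fun t => C * exp (K * t))
    (fun t => by
      have := ((((hasDerivAt_id t).const_mul K).exp).const_mul C).div_const K
      refine this.congr_deriv ?_
      simp; field_simp)
    (fun t => by
      have := (((((hasDerivAt_id t).const_mul K).exp).const_mul C).div_const (K ^ 2)).sub
        ((hasDerivAt_id t).const_mul (C * exp (K * 0) / K))
      refine this.congr_deriv ?_
      simp; field_simp) hh ht
  have h5 : 0 ≤ C * exp (K * 0) / K * t := by have := ht.1; positivity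
  have h6 : 0 ≤ C * exp (K * 0) / K ^ 2 := by positivity
  simp only [mul_zero, sub_zero] at h1 h5 h6
  linarith

/-- Two solutions whose forcing terms are close in the Lipschitz sense stay close. -/
theorem stability (d : ℕ) {L : ℝ} (hL : 0 ≤ L) : ∃ C > 0, ∀ h₁ u₁ v₁ h₂ u₂ v₂ : ℝ → ℝ,
    IsRadialSol d h₁ u₁ v₁ → IsRadialSol d h₂ u₂ v₂ → ∀ ε ≥ 0,
    (∀ t ∈ Icc 0 (π / 2), |h₁ t - h₂ t| ≤ L * |u₁ t - u₂ t| + ε) →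
    ∀ t ∈ Icc 0 (π / 2), |u₁ t - u₂ t| ≤ C * (|u₁ 0 - u₂ 0| + ε) ∧
      |v₁ t - v₂ t| ≤ C * (|u₁ 0 - u₂ 0| + ε) := by
  set K : ℝ := √(2 * L) + 1 with hKdef
  have hK1 : 1 ≤ K := by have := sqrt_nonneg (2 * L); linarith
  have hK0 : 0 < K := by linarith
  have hKL : 2 * L ≤ K ^ 2 := by
    have h1 := sqrt_nonneg (2 * L)
    have h2 := sq_sqrt (show 0 ≤ 2 * L by linarith)
    nlinarith
  refine ⟨(2 * L + 2) * exp (K * (π / 2)), by positivity, ?_⟩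
  intro h₁ u₁ v₁ h₂ u₂ v₂ H₁ H₂ ε hε hh
  have H := H₁.sub H₂
  have hne : (Icc (0 : ℝ) (π / 2)).Nonempty := ⟨0, left_mem_Icc.2 (by positivity)⟩
  have hcont : ContinuousOn (fun t => exp (-(K * t)) * |u₁ t - u₂ t|) (Icc 0 (π / 2)) :=
    (Continuous.continuousOn (by fun_prop)).mul H.u_cont.abs
  obtain ⟨x, hx, hmax⟩ := isCompact_Icc.exists_isMaxOn hne hcont
  set N : ℝ := exp (-(K * x)) * |u₁ x - u₂ x| with hN
  set D : ℝ := |u₁ 0 - u₂ 0| with hD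
  have hN0 : 0 ≤ N := by positivity
  have hD0 : 0 ≤ D := abs_nonneg _
  have hbd : ∀ t ∈ Icc 0 (π / 2), |u₁ t - u₂ t| ≤ N * exp (K * t) := by
    intro t ht
    have h1 : exp (-(K * t)) * |u₁ t - u₂ t| ≤ N := hmax ht
    have h2 : exp (-(K * t)) * exp (K * t) = 1 := by rw [← exp_add]; simp
    have h3 : 0 < exp (K * t) := exp_pos _
    calc |u₁ t - u₂ t| = (exp (-(K * t)) * |u₁ t - u₂ t|) * exp (K * t) := by
          rw [mul_right_comm, h2, one_mul]
      _ ≤ N * exp (K * t) := by gcongr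
  have hforce : ∀ t ∈ Icc 0 (π / 2), |h₁ t - h₂ t| ≤ (L * N + ε) * exp (K * t) := by
    intro t ht
    have h4 : (1 : ℝ) ≤ exp (K * t) := one_le_exp (mul_nonneg hK0.le ht.1)
    have h5 := hbd t ht
    have h6 := hh t ht
    nlinarith [mul_le_mul_of_nonneg_left h5 hL]
  have hu := fun t ht => H.abs_u_sub_le_exp (C := L * N + ε) (by positivity) hK0
    (fun t ht => hforce t (Ioo_subset_Icc_self ht)) (t := t) ht
  have hv := fun t ht => H.abs_v_le_exp (C := L * N + ε) (by positivity) hK0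
    (fun t ht => hforce t (Ioo_subset_Icc_self ht)) (t := t) ht
  have hNle : N ≤ 2 * (D + ε) := by
    have h1 := hu x hx
    have h2 : |u₁ x - u₂ x| ≤ D + (L * N + ε) * exp (K * x) / K ^ 2 := by
      have := abs_sub_abs_le_abs_sub (u₁ x - u₂ x) (u₁ 0 - u₂ 0)
      linarith
    have h3 : exp (-(K * x)) * exp (K * x) = 1 := by rw [← exp_add]; simp
    have h4 : exp (-(K * x)) ≤ 1 := exp_le_one_iff.2 (by have := mul_nonneg hK0.le hx.1; linarith)
    have h5 : N ≤ D + (L * N + ε) / K ^ 2 := by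
      calc N ≤ exp (-(K * x)) * (D + (L * N + ε) * exp (K * x) / K ^ 2) := by
            rw [hN]; gcongr
        _ = exp (-(K * x)) * D + (exp (-(K * x)) * exp (K * x)) * (L * N + ε) / K ^ 2 := by ring
        _ ≤ D + (L * N + ε) / K ^ 2 := by
            rw [h3, one_mul]
            have := mul_le_of_le_one_left hD0 h4
            linarith
    have h6 : (L * N + ε) / K ^ 2 ≤ N / 2 + ε := by
      rw [div_le_iff₀ (by positivity)]
      nlinarith [mul_nonneg hN0 (sub_nonneg.2 hKL), mul_nonneg hε (show 0 ≤ K ^ 2 - 1 by nlinarith)]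
    linarith
  intro t ht
  have hexp : exp (K * t) ≤ exp (K * (π / 2)) := by
    apply exp_le_exp.2
    exact mul_le_mul_of_nonneg_left ht.2 hK0.le
  have hDε : 0 ≤ D + ε := by positivity
  constructor
  · calc |u₁ t - u₂ t| ≤ N * exp (K * t) := hbd t ht
      _ ≤ (2 * (D + ε)) * exp (K * (π / 2)) := by gcongr
      _ ≤ (2 * L + 2) * exp (K * (π / 2)) * (D + ε) := by
        have : 0 ≤ L * exp (K * (π / 2)) * (D + ε) := by positivity
        nlinarith
  · calc |v₁ t - v₂ t| ≤ (L * N + ε) * exp (K * t) / K := hv t ht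
      _ ≤ (L * N + ε) * exp (K * t) := div_le_self (by positivity) hK1
      _ ≤ (L * (2 * (D + ε)) + (D + ε)) * exp (K * (π / 2)) := by
        gcongr
        linarith
      _ ≤ (2 * L + 2) * exp (K * (π / 2)) * (D + ε) := by
        have : 0 ≤ exp (K * (π / 2)) * (D + ε) := by positivity
        nlinarith

theorem unique {L : ℝ} (hL : 0 ≤ L) {h₁ u₁ v₁ h₂ u₂ v₂ : ℝ → ℝ}
    (H₁ : IsRadialSol d h₁ u₁ v₁) (H₂ : IsRadialSol d h₂ u₂ v₂) (h0 : u₁ 0 = u₂ 0)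
    (hh : ∀ t ∈ Icc 0 (π / 2), |h₁ t - h₂ t| ≤ L * |u₁ t - u₂ t|) :
    ∀ t ∈ Icc 0 (π / 2), u₁ t = u₂ t ∧ v₁ t = v₂ t := by
  obtain ⟨C, -, hC⟩ := stability d hL
  intro t ht
  obtain ⟨h1, h2⟩ := hC _ _ _ _ _ _ H₁ H₂ 0 le_rfl (by simpa using hh) t ht
  rw [h0, sub_self, abs_zero, add_zero, mul_zero] at h1 h2
  exact ⟨sub_eq_zero.1 (abs_nonpos_iff.1 h1), sub_eq_zero.1 (abs_nonpos_iff.1 h2)⟩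

/-- A solution passing through an equilibrium `a` with vanishing derivative starts at `a`. -/
theorem eq_of_hits (H : IsRadialSol d h u v) {L a : ℝ} (hL : 0 ≤ L)
    (hh : ∀ t ∈ Icc 0 (π / 2), |h t| ≤ L * |u t - a|) {t₀ : ℝ} (ht₀ : t₀ ∈ Ioc 0 (π / 2))
    (hu : u t₀ = a) (hv : v t₀ = 0) : u 0 = a := by
  have key : ∀ ε ∈ Ioo 0 t₀, u ε = a := by
    intro ε hε
    have hsub : Icc ε t₀ ⊆ Icc 0 (π / 2) := Icc_subset_Icc hε.1.le ht₀.2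
    have hsub' : Ioo ε t₀ ⊆ Ioo 0 (π / 2) := Ioo_subset_Ioo hε.1.le ht₀.2
    have hsε : 0 < sin ε ^ d :=
      pow_pos (sin_pos_of_mem_hemisphere ⟨hε.1, by linarith [hε.2, ht₀.2]⟩) d
    set M : ℝ := 1 / sin ε ^ d + L with hM
    have hmono := monotoneOn_Icc_of_hasDerivAt
      (f := fun t => ((u t - a) ^ 2 + v t ^ 2) * exp (M * t))
      (f' := fun t => ((2 * (u t - a) * (v t / sin t ^ d) + 2 * v t * (-(sin t ^ d * h t)))
        * exp (M * t) + ((u t - a) ^ 2 + v t ^ 2) * (M * exp (M * t))))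
      (a := ε) (b := t₀)
      (((((H.u_cont.mono hsub).sub continuousOn_const).pow 2).add
        ((H.v_cont.mono hsub).pow 2)).mul (Continuous.continuousOn (by fun_prop)))
      (fun t ht => by
        have e1 := ((H.u_deriv t (hsub' ht)).sub_const a).pow 2
        have e2 := (H.v_deriv t (hsub' ht)).pow 2
        have e3 := ((hasDerivAt_id t).const_mul M).exp
        have := (e1.add e2).mul e3
        refine this.congr_deriv ?_
        simp only [Pi.add_apply, Pi.pow_apply, id, Nat.cast_ofNat]
        ring)
      (fun t ht => by
        have ht' := hsub' ht
        have hs : 0 < sin t ^ d :=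
          pow_pos (sin_pos_of_mem_hemisphere (Ioo_subset_Ioc_self ht')) d
        have hs1 : sin t ^ d ≤ 1 := pow_le_one₀ (sin_pos_of_mem_hemisphere
          (Ioo_subset_Ioc_self ht')).le (sin_le_one t)
        have hεs : sin ε ^ d ≤ sin t ^ d :=
          pow_le_pow_left₀ (sin_pos_of_mem_hemisphere ⟨hε.1, by linarith [hε.2, ht₀.2]⟩).le
            (sin_le_sin_of_hemisphere hε.1.le ht.1.le ht'.2.le) d
        have hinv : 1 / sin t ^ d ≤ 1 / sin ε ^ d := one_div_le_one_div_of_le hsε hεs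
        have hinv0 : 0 < 1 / sin t ^ d := by positivity
        set x := |u t - a|
        set y := |v t|
        have hx : (u t - a) ^ 2 = x ^ 2 := (sq_abs _).symm
        have hy : v t ^ 2 = y ^ 2 := (sq_abs _).symm
        have hx0 : 0 ≤ x := abs_nonneg _
        have hy0 : 0 ≤ y := abs_nonneg _
        have b1 : -(2 * (u t - a) * (v t / sin t ^ d)) ≤ 2 * x * y * (1 / sin ε ^ d) := by
          calc -(2 * (u t - a) * (v t / sin t ^ d)) ≤ |2 * (u t - a) * (v t / sin t ^ d)| :=
                neg_le_abs _
            _ = 2 * x * y * (1 / sin t ^ d) := by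
                rw [abs_mul, abs_mul, abs_div, abs_two, abs_of_pos hs]; ring
            _ ≤ _ := by gcongr
        have b2 : -(2 * v t * (-(sin t ^ d * h t))) ≤ 2 * L * x * y := by
          calc -(2 * v t * (-(sin t ^ d * h t))) ≤ |2 * v t * (-(sin t ^ d * h t))| :=
                neg_le_abs _
            _ = 2 * y * (sin t ^ d * |h t|) := by
                rw [abs_mul, abs_mul, abs_neg, abs_mul, abs_two, abs_of_pos hs]
            _ ≤ 2 * y * (1 * (L * x)) := by
                gcongr
                exact hh t (Ioo_subset_Icc_self ht')
            _ = _ := by ring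
        have b3 : 2 * x * y ≤ x ^ 2 + y ^ 2 := two_mul_le_add_sq x y
        have b4 : 2 * x * y * M ≤ (x ^ 2 + y ^ 2) * M := by
          have : 0 ≤ M := by positivity
          gcongr
        rw [hx, hy]
        have : 0 ≤ (2 * (u t - a) * (v t / sin t ^ d) + 2 * v t * (-(sin t ^ d * h t))
          + (x ^ 2 + y ^ 2) * M) * exp (M * t) := by
          apply mul_nonneg _ (exp_pos _).le
          have : 2 * x * y * M = 2 * x * y * (1 / sin ε ^ d) + 2 * L * x * y := by
            rw [hM]; ring
          linarith
        linarith)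
      (left_mem_Icc.2 hε.2.le) (right_mem_Icc.2 hε.2.le) hε.2.le
    simp only [hu, hv] at hmono
    have hpos : 0 < exp (M * ε) := exp_pos _
    have h1 : ((u ε - a) ^ 2 + v ε ^ 2) * exp (M * ε) ≤ 0 := by simpa using hmono
    have h2 : (u ε - a) ^ 2 + v ε ^ 2 ≤ 0 := by
      by_contra hcon
      push Not at hcon
      exact absurd (mul_pos hcon hpos) (not_lt.2 h1)
    have h3 : (u ε - a) ^ 2 = 0 := le_antisymm (by nlinarith [sq_nonneg (v ε)]) (sq_nonneg _)
    exact sub_eq_zero.1 (pow_eq_zero_iff two_ne_zero |>.1 h3)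
  have hc : Filter.Tendsto u (nhdsWithin 0 (Ioo 0 t₀)) (nhds (u 0)) :=
    ((H.u_cont 0 (left_mem_Icc.2 (by positivity))).mono
      (fun x hx => ⟨hx.1.le, by linarith [hx.2, ht₀.2]⟩))
  have hc' : Filter.Tendsto u (nhdsWithin 0 (Ioo 0 t₀)) (nhds a) := by
    refine tendsto_const_nhds.congr' ?_
    filter_upwards [self_mem_nhdsWithin] with x hx
    exact (key x hx).symm
  have : (nhdsWithin (0 : ℝ) (Ioo 0 t₀)).NeBot := by
    rw [← mem_closure_iff_nhdsWithin_neBot, closure_Ioo ht₀.1.ne]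
    exact left_mem_Icc.2 ht₀.1.le
  exact tendsto_nhds_unique hc hc'

theorem hasDerivAt_deriv (H : IsRadialSol d h u v) {t : ℝ} (ht : t ∈ Ioo 0 (π / 2)) :
    HasDerivAt (fun t => v t / sin t ^ d)
      (-h t - d * (cos t / sin t) * (v t / sin t ^ d)) t := by
  have hs := sin_pos_of_mem_hemisphere (Ioo_subset_Ioc_self ht)
  have := (H.v_deriv t ht).div ((hasDerivAt_sin t).pow d) (pow_pos hs d).ne'
  refine this.congr_deriv ?_
  rcases Nat.eq_zero_or_pos d with rfl | hd
  · simp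
  · obtain ⟨k, rfl⟩ := Nat.exists_eq_succ_of_ne_zero hd.ne'
    simp only [Nat.succ_eq_add_one, Nat.add_sub_cancel, Pi.pow_apply]
    field_simp
    ring

end IsRadialSol

/-! ### Existence -/

namespace IsRadialSol

theorem exists_of_continuous {d : ℕ} (hd : d ≠ 0) {h : ℝ → ℝ} (hh : Continuous h) (a : ℝ) :
    ∃ u v : ℝ → ℝ, IsRadialSol d h u v ∧ u 0 = a := by
  have hcont : Continuous fun q => sin q ^ d * h q := by fun_prop
  set v : ℝ → ℝ := fun t => -∫ q in (0 : ℝ)..t, sin q ^ d * h q with hv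
  have hvd : ∀ t, HasDerivAt v (-(sin t ^ d * h t)) t := fun t =>
    (hcont.integral_hasStrictDerivAt 0 t).hasDerivAt.neg
  have F : IsRadialFlux d h v :=
    ⟨(continuous_iff_continuousAt.2 fun t => (hvd t).continuousAt).continuousOn, by simp [hv],
      fun t _ => hvd t⟩
  have hle : (0 : ℝ) ≤ π / 2 := by positivity
  obtain ⟨C, hC⟩ := isCompact_Icc.exists_bound_of_continuousOn (s := Icc 0 (π / 2)) hh.continuousOn
  have hz := F.continuousOn_deriv hd (C := C) (fun t ht => hC t (Ioo_subset_Icc_self ht))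
  set z : ℝ → ℝ := IccExtend hle (Set.domRestrict (Icc 0 (π / 2)) fun t => v t / sin t ^ d) with hzdef
  have hzc : Continuous z := hz.domRestrict.Icc_extend'
  have hud : ∀ t, HasDerivAt (fun t => a + ∫ q in (0 : ℝ)..t, z q) (z t) t := fun t =>
    (hzc.integral_hasStrictDerivAt 0 t).hasDerivAt.const_add a
  refine ⟨fun t => a + ∫ q in (0 : ℝ)..t, z q, v, ⟨F,
    (continuous_iff_continuousAt.2 fun t => (hud t).continuousAt).continuousOn, ?_⟩, by simp⟩
  intro t ht
  refine (hud t).congr_deriv ?_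
  rw [hzdef, IccExtend_of_mem hle _ (Ioo_subset_Icc_self ht)]
  rfl

theorem exists_of_lipschitz {d : ℕ} (hd : d ≠ 0) {f : ℝ → ℝ} {L : ℝ} (hL : 0 ≤ L)
    (hf : ∀ x y, |f x - f y| ≤ L * |x - y|) (a : ℝ) :
    ∃ u v : ℝ → ℝ, IsRadialSol d (fun t => f (u t)) u v ∧ u 0 = a := by
  have hle : (0 : ℝ) ≤ π / 2 := by positivity
  have hfc : Continuous f := by
    refine (LipschitzWith.of_dist_le_mul (K := ⟨L, hL⟩) fun x y => ?_).continuous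
    exact hf x y
  set K : ℝ := √(2 * L) + 1 with hKdef
  have hK1 : 1 ≤ K := by have := sqrt_nonneg (2 * L); linarith
  have hK0 : 0 < K := by linarith
  have hKL : 2 * L ≤ K ^ 2 := by
    have h1 := sqrt_nonneg (2 * L)
    have h2 := sq_sqrt (show 0 ≤ 2 * L by linarith)
    nlinarith
  have step : ∀ x : C(Icc (0 : ℝ) (π / 2), ℝ), ∃ u v : ℝ → ℝ,
      IsRadialSol d (fun t => f (exp (K * t) * IccExtend hle x t)) u v ∧ u 0 = a := fun x =>
    exists_of_continuous hd
      (hfc.comp ((by fun_prop : Continuous fun t => exp (K * t)).mul x.continuous.Icc_extend')) a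
  choose u v H h0 using step
  set Φ : C(Icc (0 : ℝ) (π / 2), ℝ) → C(Icc (0 : ℝ) (π / 2), ℝ) := fun x =>
    ⟨fun t => exp (-(K * t)) * u x t, (Continuous.mul (by fun_prop)
      (continuousOn_iff_continuous_domRestrict.1 (H x).u_cont))⟩ with hΦ
  have hcontr : ContractingWith (1 / 2) Φ := by
    refine ⟨by norm_num, LipschitzWith.of_dist_le_mul fun x y => ?_⟩
    rw [ContinuousMap.dist_le (by positivity)]
    intro t
    have hsub := (H x).sub (H y)
    have := hsub.abs_u_sub_le_exp (C := L * dist x y) (K := K) (by positivity) hK0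
      (fun q hq => by
        refine (hf _ _).trans ?_
        rw [← mul_sub, abs_mul, abs_of_pos (exp_pos _),
          IccExtend_of_mem hle _ (Ioo_subset_Icc_self hq),
          IccExtend_of_mem hle _ (Ioo_subset_Icc_self hq)]
        have h1 := ContinuousMap.dist_apply_le_dist (f := x) (g := y)
          ⟨q, Ioo_subset_Icc_self hq⟩
        rw [Real.dist_eq] at h1
        calc _ ≤ L * (exp (K * q) * dist x y) := by gcongr
          _ = _ := by ring) t.2
    simp only [h0, sub_self, sub_zero] at this
    have e : exp (-(K * t)) * exp (K * t) = 1 := by rw [← exp_add]; simp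
    have hNN : ((1 / 2 : NNReal) : ℝ) = 1 / 2 := by norm_num
    rw [hNN, Real.dist_eq]
    change |exp (-(K * t)) * u x t - exp (-(K * t)) * u y t| ≤ _
    rw [← mul_sub, abs_mul, abs_of_pos (exp_pos _)]
    calc exp (-(K * t)) * |u x t - u y t|
        ≤ exp (-(K * t)) * (L * dist x y * exp (K * t) / K ^ 2) := by gcongr
      _ = (exp (-(K * t)) * exp (K * t)) * (L / K ^ 2 * dist x y) := by ring
      _ ≤ 1 / 2 * dist x y := by
        rw [e, one_mul]
        refine mul_le_mul_of_nonneg_right ?_ dist_nonneg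
        rw [div_le_iff₀ (by positivity)]
        linarith
  set x := ContractingWith.fixedPoint Φ hcontr
  have hx : Φ x = x := hcontr.fixedPoint_isFixedPt
  refine ⟨u x, v x, (H x).congr fun t ht => ?_, h0 x⟩
  have ht' := Ioo_subset_Icc_self ht
  have h1 : x ⟨t, ht'⟩ = exp (-(K * t)) * u x t := by
    conv_lhs => rw [← hx]
    rfl
  have e : exp (K * t) * exp (-(K * t)) = 1 := by rw [← exp_add]; simp
  simp only [IccExtend_of_mem hle _ ht', h1]
  rw [← mul_assoc, e, one_mul]

end IsRadialSol

/-! ### Continuous choice of an argument -/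

theorem exists_continuousOn_arg {G : ℝ × ℝ → ℂ} {a b : ℝ} (hab : a ≤ b) {K : Set ℝ}
    (hK : IsCompact K) (hG : ContinuousOn G (Icc a b ×ˢ K))
    (hne : ∀ x ∈ Icc a b ×ˢ K, G x ≠ 0) (hslit : ∀ p ∈ K, G (a, p) ∈ Complex.slitPlane) :
    ∃ θ : ℝ × ℝ → ℝ, ContinuousOn θ (Icc a b ×ˢ K) ∧ (∀ p ∈ K, θ (a, p) = (G (a, p)).arg) ∧
      ∀ x ∈ Icc a b ×ˢ K, ∃ r > 0, (G x).re = r * cos (θ x) ∧ (G x).im = r * sin (θ x) := by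
  have hcpt : IsCompact (Icc a b ×ˢ K) := isCompact_Icc.prod hK
  have huc := hcpt.uniformContinuousOn_of_continuous hG
  obtain ⟨δ, hδ, hGδ⟩ : ∃ δ > 0, ∀ x ∈ Icc a b ×ˢ K, δ ≤ ‖G x‖ := by
    rcases (Icc a b ×ˢ K).eq_empty_or_nonempty with h | h
    · exact ⟨1, one_pos, by simp [h]⟩
    · obtain ⟨x, hx, hmin⟩ := hcpt.exists_isMinOn h hG.norm
      exact ⟨‖G x‖, norm_pos_iff.2 (hne x hx), fun y hy => hmin hy⟩
  obtain ⟨η, hη, hη'⟩ := Metric.uniformContinuousOn_iff.1 huc δ hδ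
  obtain ⟨N, hN⟩ := exists_nat_gt ((b - a) / η)
  have hN0 : 0 < (N : ℝ) := lt_of_le_of_lt (div_nonneg (by linarith) hη.le) hN
  set c : ℕ → ℝ × ℝ → ℝ × ℝ := fun i x => (a + i / N * (x.1 - a), x.2) with hc
  have hcmem : ∀ i ≤ N, ∀ x ∈ Icc a b ×ˢ K, c i x ∈ Icc a b ×ˢ K := by
    intro i hi x hx
    have h1 : (i : ℝ) / N ≤ 1 := by
      rw [div_le_one hN0]; exact_mod_cast hi
    have h0 : 0 ≤ (i : ℝ) / N := by positivity
    have h2 := hx.1.1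
    have h3 := hx.1.2
    refine ⟨⟨?_, ?_⟩, hx.2⟩
    · simp only [hc]; nlinarith
    · simp only [hc]; nlinarith
  have hcc : ∀ i, Continuous (c i) := fun i => by simp only [hc]; fun_prop
  have hratio : ∀ i < N, ∀ x ∈ Icc a b ×ˢ K,
      G (c (i + 1) x) / G (c i x) ∈ Complex.slitPlane := by
    intro i hi x hx
    have h1 := hcmem i hi.le x hx
    have h2 := hcmem (i + 1) hi x hx
    have h3 : dist (c (i + 1) x) (c i x) < η := by
      rw [Prod.dist_eq]
      simp only [hc, dist_self, Real.dist_eq]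
      have h4 : a + ((i + 1 : ℕ) : ℝ) / N * (x.1 - a) - (a + (i : ℝ) / N * (x.1 - a))
          = (x.1 - a) / N := by push_cast; field_simp; ring
      have h5 := hx.1.1
      have h6 := hx.1.2
      rw [h4, abs_of_nonneg (div_nonneg (by linarith) hN0.le), max_lt_iff]
      refine ⟨?_, hη⟩
      rw [div_lt_iff₀ hη] at hN
      rw [div_lt_iff₀ hN0]
      nlinarith
    have h4 := hη' _ h2 _ h1 h3
    rw [dist_eq_norm] at h4
    have h5 : ‖G (c (i + 1) x) / G (c i x) - 1‖ < 1 := by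
      have hz := hne _ h1
      have hz' : 0 < ‖G (c i x)‖ := norm_pos_iff.2 hz
      rw [div_sub_one hz, norm_div, div_lt_one hz']
      exact h4.trans_le (hGδ _ h1)
    refine Complex.mem_slitPlane_iff.2 (Or.inl ?_)
    have h6 := (abs_le.1 (Complex.abs_re_le_norm (G (c (i + 1) x) / G (c i x) - 1))).1
    simp only [Complex.sub_re, Complex.one_re] at h6
    linarith
  have hGc : ∀ i ≤ N, ContinuousOn (fun x => G (c i x)) (Icc a b ×ˢ K) := fun i hi =>
    hG.comp (hcc i).continuousOn (hcmem i hi)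
  set Λ : ℕ → ℝ × ℝ → ℂ := fun n x => Complex.log (G (a, x.2)) +
    ∑ i ∈ Finset.range n, Complex.log (G (c (i + 1) x) / G (c i x)) with hΛ
  have hΛexp : ∀ n ≤ N, ∀ x ∈ Icc a b ×ˢ K, Complex.exp (Λ n x) = G (c n x) := by
    intro n
    induction n with
    | zero =>
      intro _ x hx
      have : c 0 x = (a, x.2) := by simp [hc]
      simp only [hΛ, Finset.range_zero, Finset.sum_empty, add_zero, this]
      exact Complex.exp_log (Complex.slitPlane_ne_zero (hslit _ hx.2))
    | succ n ih =>
      intro hn x hx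
      have h1 := ih (by omega) x hx
      have h2 : Λ (n + 1) x = Λ n x + Complex.log (G (c (n + 1) x) / G (c n x)) := by
        simp only [hΛ, Finset.sum_range_succ]; ring
      rw [h2, Complex.exp_add, h1,
        Complex.exp_log (Complex.slitPlane_ne_zero (hratio n hn x hx))]
      exact mul_div_cancel₀ _ (hne _ (hcmem n (by omega) x hx))
  have hΛc : ContinuousOn (Λ N) (Icc a b ×ˢ K) := by
    refine ContinuousOn.add ?_ (continuousOn_finsetSum _ fun i hi => ?_)
    · refine ContinuousOn.clog ?_ fun x hx => hslit _ hx.2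
      exact hG.comp (by fun_prop : Continuous fun x : ℝ × ℝ => (a, x.2)).continuousOn
        fun x hx => ⟨left_mem_Icc.2 hab, hx.2⟩
    · have hi' := Finset.mem_range.1 hi
      exact ((hGc _ hi').div (hGc _ hi'.le) fun x hx => hne _ (hcmem _ hi'.le x hx)).clog
        (hratio i hi')
  refine ⟨fun x => (Λ N x).im, Complex.continuous_im.comp_continuousOn hΛc, ?_, ?_⟩
  · intro p hp
    have h1 : ∀ i, c i (a, p) = (a, p) := fun i => by simp [hc]
    have h2 : G (a, p) ≠ 0 := hne _ ⟨left_mem_Icc.2 hab, hp⟩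
    simp [hΛ, h1, div_self h2, Complex.log_im]
  · intro x hx
    refine ⟨exp (Λ N x).re, exp_pos _, ?_⟩
    have h1 : c N x = x := by
      simp only [hc]; rw [div_self hN0.ne']; simp
    have h2 := hΛexp N le_rfl x hx
    rw [h1] at h2
    rw [← h2, Complex.exp_re, Complex.exp_im]
    exact ⟨rfl, rfl⟩

theorem lt_of_forall_ne {θ : ℝ → ℝ} {a b c : ℝ} (hab : a ≤ b) (hθ : ContinuousOn θ (Icc a b))
    (ha : θ a < c) (hne : ∀ t ∈ Icc a b, θ t ≠ c) : θ b < c := by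
  by_contra hcon
  push Not at hcon
  obtain ⟨t, ht, htc⟩ := intermediate_value_Icc hab hθ ⟨ha.le, hcon⟩
  exact hne t ht htc

/-- Two plane curves in the closed quadrant, one leaving a small neighbourhood of the origin and
ending on the horizontal axis, the other joining a point of the horizontal axis closer to the
origin to the vertical axis, must intersect. -/
theorem exists_crossing {x y X Y : ℝ → ℝ} {a₀ a₁ b₀ b₁ : ℝ} (ha : a₀ < a₁) (hb : b₀ < b₁)
    (hx : ContinuousOn x (Icc a₀ a₁)) (hy : ContinuousOn y (Icc a₀ a₁))
    (hX : ContinuousOn X (Icc b₀ b₁)) (hY : ContinuousOn Y (Icc b₀ b₁))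
    (hxpos : ∀ s ∈ Icc a₀ a₁, 0 < x s) (hypos : ∀ s ∈ Ico a₀ a₁, 0 < y s) (hya₁ : y a₁ = 0)
    (hYb₀ : Y b₀ = 0) (hYpos : ∀ s ∈ Ioc b₀ b₁, 0 < Y s) (hXb₁ : X b₁ = 0) (hXx : X b₀ < x a₁)
    (hsmall : ∀ s ∈ Icc b₀ b₁, x a₀ + y a₀ < X s + Y s) :
    ∃ α ∈ Icc a₀ a₁, ∃ β ∈ Icc b₀ b₁, x α = X β ∧ y α = Y β := by
  by_contra! hcon
  have ha₀ : a₀ ∈ Icc a₀ a₁ := left_mem_Icc.2 ha.le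
  have ha₁ : a₁ ∈ Icc a₀ a₁ := right_mem_Icc.2 ha.le
  have hb₀ : b₀ ∈ Icc b₀ b₁ := left_mem_Icc.2 hb.le
  have hb₁ : b₁ ∈ Icc b₀ b₁ := right_mem_Icc.2 hb.le
  set G : ℝ × ℝ → ℂ := fun z => ⟨X z.2 - x z.1, Y z.2 - y z.1⟩ with hGdef
  have hfst : MapsTo (Prod.fst : ℝ × ℝ → ℝ) (Icc a₀ a₁ ×ˢ Icc b₀ b₁) (Icc a₀ a₁) :=
    fun z hz => hz.1
  have hsnd : MapsTo (Prod.snd : ℝ × ℝ → ℝ) (Icc a₀ a₁ ×ˢ Icc b₀ b₁) (Icc b₀ b₁) :=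
    fun z hz => hz.2
  have hG : ContinuousOn G (Icc a₀ a₁ ×ˢ Icc b₀ b₁) := by
    have h1 : ContinuousOn (fun z : ℝ × ℝ => X z.2 - x z.1) (Icc a₀ a₁ ×ˢ Icc b₀ b₁) :=
      (hX.comp continuous_snd.continuousOn hsnd).sub (hx.comp continuous_fst.continuousOn hfst)
    have h2 : ContinuousOn (fun z : ℝ × ℝ => Y z.2 - y z.1) (Icc a₀ a₁ ×ˢ Icc b₀ b₁) :=
      (hY.comp continuous_snd.continuousOn hsnd).sub (hy.comp continuous_fst.continuousOn hfst)
    exact Complex.equivRealProdCLM.symm.continuous.comp_continuousOn (h1.prodMk h2)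
  obtain ⟨θ, hθ, harg, hpol⟩ := exists_continuousOn_arg ha.le isCompact_Icc hG
    (fun z hz h0 => by
      have h1 := congrArg Complex.re h0
      have h2 := congrArg Complex.im h0
      simp only [hGdef, Complex.zero_re, Complex.zero_im] at h1 h2
      exact hcon z.1 hz.1 z.2 hz.2 (by linarith) (by linarith))
    (fun p hp => by
      have := hsmall p hp
      rw [Complex.mem_slitPlane_iff]
      simp only [hGdef]
      by_contra! h
      linarith [h.1, h.2])
  have hy₀ := hypos a₀ ⟨le_rfl, ha⟩
  have hx₀ := hxpos a₀ ha₀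
  -- along the bottom edge
  have e1 : θ (a₁, b₀) < 0 := by
    refine lt_of_forall_ne (θ := fun s => θ (s, b₀)) ha.le
      (hθ.comp (by fun_prop : Continuous fun s : ℝ => (s, b₀)).continuousOn
        fun s hs => ⟨hs, hb₀⟩) ?_ ?_
    · simp only [harg b₀ hb₀]
      rw [Complex.arg_neg_iff]
      simp only [hGdef]
      linarith
    · intro s hs h0
      obtain ⟨r, hr, h1, h2⟩ := hpol (s, b₀) ⟨hs, hb₀⟩
      rw [h0] at h1 h2
      simp only [hGdef, cos_zero, sin_zero, mul_one, mul_zero] at h1 h2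
      rcases eq_or_lt_of_le hs.2 with h | h
      · rw [h] at h1; linarith
      · have := hypos s ⟨hs.1, h⟩; linarith
  -- along the right edge
  have e2 : θ (a₁, b₁) < 0 := by
    refine lt_of_forall_ne (θ := fun s => θ (a₁, s)) hb.le
      (hθ.comp (by fun_prop : Continuous fun s : ℝ => (a₁, s)).continuousOn
        fun s hs => ⟨ha₁, hs⟩) e1 ?_
    intro s hs h0
    obtain ⟨r, hr, h1, h2⟩ := hpol (a₁, s) ⟨ha₁, hs⟩
    rw [h0] at h2
    simp only [hGdef, sin_zero, mul_zero] at h2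
    rcases eq_or_lt_of_le hs.1 with h | h
    · rw [← h] at h0; linarith
    · have := hYpos s ⟨h, hs.2⟩; linarith
  -- along the top edge
  have e3 : -θ (a₁, b₁) < -(π / 2) := by
    refine lt_of_forall_ne (θ := fun s => -θ (s, b₁)) ha.le
      (hθ.comp (by fun_prop : Continuous fun s : ℝ => (s, b₁)).continuousOn
        fun s hs => ⟨hs, hb₁⟩).neg ?_ ?_
    · simp only [harg b₁ hb₁]
      have h1 := hsmall b₁ hb₁
      rw [neg_lt_neg_iff]
      by_contra! hle
      have := Complex.arg_le_pi_div_two_iff.1 hle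
      simp only [hGdef] at this
      rcases this with h | h <;> linarith
    · intro s hs h0
      obtain ⟨r, hr, h1, h2⟩ := hpol (s, b₁) ⟨hs, hb₁⟩
      simp only [neg_inj] at h0
      rw [h0] at h1
      simp only [hGdef, cos_pi_div_two, mul_zero] at h1
      have := hxpos s hs
      linarith
  linarith [pi_pos]

/-! ### Prüfer angles and Sturm comparison -/

/-- A continuous Prüfer angle of the pair `(w, v)`, normalised to vanish at the pole. -/
structure IsPruferAngle (w v θ : ℝ → ℝ) : Prop where
  cont : ContinuousOn θ (Icc 0 (π / 2))
  zero : θ 0 = 0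
  polar : ∀ t ∈ Icc 0 (π / 2), ∃ r > 0, w t = r * cos (θ t) ∧ v t = -(r * sin (θ t))

theorem exists_pruferAngle_family {d : ℕ} {W V : ℝ → ℝ → ℝ} {K : Set ℝ} (hK : IsCompact K)
    (hW : ContinuousOn (fun x : ℝ × ℝ => W x.2 x.1) (Icc 0 (π / 2) ×ˢ K))
    (hV : ContinuousOn (fun x : ℝ × ℝ => V x.2 x.1) (Icc 0 (π / 2) ×ˢ K))
    {L : ℝ} (hL : 0 ≤ L) {h : ℝ → ℝ → ℝ} (H : ∀ α ∈ K, IsRadialSol d (h α) (W α) (V α))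
    (hh : ∀ α ∈ K, ∀ t ∈ Icc 0 (π / 2), |h α t| ≤ L * |W α t|) (h0 : ∀ α ∈ K, W α 0 = 1) :
    ∃ θ : ℝ → ℝ → ℝ, (∀ α ∈ K, IsPruferAngle (W α) (V α) (θ α)) ∧
      ContinuousOn (fun α => θ α (π / 2)) K := by
  have hle : (0 : ℝ) ≤ π / 2 := by positivity
  set G : ℝ × ℝ → ℂ := fun x => ⟨W x.2 x.1, -V x.2 x.1⟩ with hG
  have hG0 : ∀ α ∈ K, G (0, α) = 1 := by
    intro α hα
    simp only [hG, h0 α hα, (H α hα).v_zero, neg_zero]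
    rfl
  obtain ⟨θ, hθ, harg, hpol⟩ := exists_continuousOn_arg (G := G) hle hK
    (Complex.equivRealProdCLM.symm.continuous.comp_continuousOn (hW.prodMk hV.neg))
    (fun x hx hx0 => by
      have h1 : W x.2 x.1 = 0 := congrArg Complex.re hx0
      have h2 : -V x.2 x.1 = 0 := congrArg Complex.im hx0
      have hw := h0 x.2 hx.2
      rcases eq_or_lt_of_le hx.1.1 with h | h
      · rw [← h] at h1; linarith
      · have := (H x.2 hx.2).eq_of_hits (a := 0) hL (by simpa using hh x.2 hx.2) ⟨h, hx.1.2⟩ h1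
          (by linarith)
        linarith)
    (fun α hα => by rw [hG0 α hα]; exact Complex.one_mem_slitPlane)
  refine ⟨fun α t => θ (t, α), fun α hα => ⟨?_, ?_, fun t ht => ?_⟩, ?_⟩
  · exact hθ.comp (by fun_prop : Continuous fun t : ℝ => (t, α)).continuousOn
      fun t ht => ⟨ht, hα⟩
  · simp [harg α hα, hG0 α hα]
  · obtain ⟨r, hr, h1, h2⟩ := hpol (t, α) ⟨ht, hα⟩
    refine ⟨r, hr, h1, ?_⟩
    have h3 : -V α t = r * sin (θ (t, α)) := h2
    linarith
  · exact hθ.comp (by fun_prop : Continuous fun α : ℝ => (π / 2, α)).continuousOn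
      fun α hα => ⟨right_mem_Icc.2 hle, hα⟩

theorem IsRadialSol.exists_pruferAngle {d : ℕ} {h w v : ℝ → ℝ} {L : ℝ} (H : IsRadialSol d h w v)
    (hL : 0 ≤ L) (hh : ∀ t ∈ Icc 0 (π / 2), |h t| ≤ L * |w t|) (h0 : w 0 = 1) :
    ∃ θ, IsPruferAngle w v θ := by
  obtain ⟨θ, hθ, -⟩ := exists_pruferAngle_family (W := fun _ => w) (V := fun _ => v)
    (h := fun _ => h) (isCompact_singleton (x := (0 : ℝ)))
    (H.u_cont.comp continuous_fst.continuousOn fun x hx => hx.1)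
    (H.v_cont.comp continuous_fst.continuousOn fun x hx => hx.1) hL
    (fun _ _ => H) (fun _ _ => hh) (fun _ _ => h0)
  exact ⟨θ 0, hθ 0 rfl⟩

/-- Just before a zero `t₀`, a solution has sign opposite to its flux at `t₀`. -/
theorem IsRadialSol.eventually_mul_neg {d : ℕ} {h w v : ℝ → ℝ} (H : IsRadialSol d h w v) {t₀ : ℝ}
    (ht₀ : t₀ ∈ Ioc 0 (π / 2)) (hw : w t₀ = 0) (hv : v t₀ ≠ 0) :
    ∀ᶠ t in nhdsWithin t₀ (Iio t₀), w t * v t₀ < 0 := by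
  have hIcc : Icc 0 (π / 2) ∈ nhdsWithin t₀ (Iio t₀) :=
    Filter.mem_of_superset (Ioo_mem_nhdsLT ht₀.1) fun t ht => ⟨ht.1.le, ht.2.le.trans ht₀.2⟩
  have hvt : ∀ᶠ t in nhdsWithin t₀ (Iio t₀), 0 < v t * v t₀ := by
    have h1 : Filter.Tendsto (fun t => v t * v t₀) (nhdsWithin t₀ (Iio t₀)) (nhds (v t₀ * v t₀)) :=
      ((H.v_cont t₀ (Ioc_subset_Icc_self ht₀)).tendsto.mono_left
        (nhdsWithin_le_of_mem hIcc)).mul_const _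
    exact h1.eventually (lt_mem_nhds (mul_self_pos.2 hv))
  obtain ⟨l, hl, hl'⟩ := mem_nhdsLT_iff_exists_Ioo_subset.1
    (Filter.inter_mem hvt (Ioo_mem_nhdsLT ht₀.1))
  filter_upwards [Ioo_mem_nhdsLT hl] with t ht
  have ht0 := (hl' ht).2
  have hsub : Icc t t₀ ⊆ Icc 0 (π / 2) := Icc_subset_Icc ht0.1.le ht₀.2
  have := strictMonoOn_Icc_of_hasDerivAt (f := fun t => w t * v t₀)
    (f' := fun t => v t / sin t ^ d * v t₀) ((H.u_cont.mono hsub).mul continuousOn_const)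
    (fun q hq => (H.u_deriv q ⟨ht0.1.trans hq.1, hq.2.trans_le ht₀.2⟩).mul_const _)
    (fun q hq => by
      have h1 : 0 < v q * v t₀ := (hl' ⟨ht.1.trans hq.1, hq.2⟩).1
      have h2 := sin_pos_of_mem_hemisphere (t := q) ⟨ht0.1.trans hq.1, hq.2.le.trans ht₀.2⟩
      rw [div_mul_eq_mul_div]
      positivity)
    (left_mem_Icc.2 ht.2.le) (right_mem_Icc.2 ht.2.le) ht.2
  simpa [hw] using this

section Comparison

variable {d : ℕ} {c₁ c₂ w₁ w₂ v₁ v₂ θ₁ θ₂ : ℝ → ℝ}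

theorem strictMonoOn_wronskian (H₁ : IsRadialSol d (fun t => c₁ t * w₁ t) w₁ v₁)
    (H₂ : IsRadialSol d (fun t => c₂ t * w₂ t) w₂ v₂)
    (hc : ∀ t ∈ Ioo 0 (π / 2), c₁ t < c₂ t) {a b : ℝ} (ha : 0 ≤ a) (hb : b ≤ π / 2)
    (hw : ∀ t ∈ Ioo a b, 0 < w₁ t * w₂ t) :
    StrictMonoOn (fun t => w₂ t * v₁ t - w₁ t * v₂ t) (Icc a b) := by
  have hsub : Icc a b ⊆ Icc 0 (π / 2) := Icc_subset_Icc ha hb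
  have hsub' : Ioo a b ⊆ Ioo 0 (π / 2) := Ioo_subset_Ioo ha hb
  refine strictMonoOn_Icc_of_hasDerivAt (f' := fun t => sin t ^ d * (c₂ t - c₁ t) * (w₁ t * w₂ t))
    (((H₂.u_cont.mono hsub).mul (H₁.v_cont.mono hsub)).sub
      ((H₁.u_cont.mono hsub).mul (H₂.v_cont.mono hsub))) (fun t ht => ?_) (fun t ht => ?_)
  · have ht' := hsub' ht
    refine (((H₂.u_deriv t ht').mul (H₁.v_deriv t ht')).sub
      ((H₁.u_deriv t ht').mul (H₂.v_deriv t ht'))).congr_deriv ?_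
    ring
  · have ht' := hsub' ht
    have h1 := sin_pos_of_mem_hemisphere (Ioo_subset_Ioc_self ht')
    have h2 := sub_pos.2 (hc t ht')
    have h3 := hw t ht
    positivity

theorem IsPruferAngle.wronskian (A₁ : IsPruferAngle w₁ v₁ θ₁) (A₂ : IsPruferAngle w₂ v₂ θ₂)
    {t : ℝ} (ht : t ∈ Icc 0 (π / 2)) :
    ∃ r > 0, w₂ t * v₁ t - w₁ t * v₂ t = r * sin (θ₂ t - θ₁ t) := by
  obtain ⟨r₁, hr₁, e1, e2⟩ := A₁.polar t ht
  obtain ⟨r₂, hr₂, e3, e4⟩ := A₂.polar t ht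
  refine ⟨r₁ * r₂, mul_pos hr₁ hr₂, ?_⟩
  rw [e1, e2, e3, e4, sin_sub]
  ring

theorem IsPruferAngle.lt (H₁ : IsRadialSol d (fun t => c₁ t * w₁ t) w₁ v₁)
    (H₂ : IsRadialSol d (fun t => c₂ t * w₂ t) w₂ v₂) (A₁ : IsPruferAngle w₁ v₁ θ₁)
    (A₂ : IsPruferAngle w₂ v₂ θ₂) (hc : ∀ t ∈ Ioo 0 (π / 2), c₁ t < c₂ t) :
    ∀ t ∈ Ioc 0 (π / 2), θ₁ t < θ₂ t := by
  have hpi := pi_pos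
  have h0mem : (0 : ℝ) ∈ Icc 0 (π / 2) := left_mem_Icc.2 (by positivity)
  have hΔc : ContinuousOn (fun t => θ₂ t - θ₁ t) (Icc 0 (π / 2)) := A₂.cont.sub A₁.cont
  -- near the pole
  obtain ⟨δ, hδ, hδ'⟩ : ∃ δ ∈ Ioc 0 (π / 2), ∀ t ∈ Ioc 0 δ, 0 < θ₂ t - θ₁ t := by
    have key : ∀ θ : ℝ → ℝ, ContinuousOn θ (Icc 0 (π / 2)) → θ 0 = 0 →
        ∀ᶠ t in nhdsWithin 0 (Icc 0 (π / 2)), |θ t| < π / 4 := by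
      intro θ hθ h0
      have h1 : Filter.Tendsto (fun t => |θ t|) (nhdsWithin 0 (Icc 0 (π / 2))) (nhds |θ 0|) :=
        (hθ 0 h0mem).abs
      rw [h0, abs_zero] at h1
      exact h1.eventually (gt_mem_nhds (by positivity))
    have hev := (key θ₁ A₁.cont A₁.zero).and (key θ₂ A₂.cont A₂.zero)
    obtain ⟨ε, hε, hball⟩ := Metric.mem_nhdsWithin_iff.1 hev
    have hsmall : ∀ t ∈ Icc 0 (min (ε / 2) (π / 2)), |θ₁ t| < π / 4 ∧ |θ₂ t| < π / 4 := by
      intro t ht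
      refine hball ⟨?_, ht.1, ht.2.trans (min_le_right _ _)⟩
      rw [Metric.mem_ball, Real.dist_eq, sub_zero, abs_of_nonneg ht.1]
      have := ht.2.trans (min_le_left _ _)
      linarith
    refine ⟨min (ε / 2) (π / 2), ⟨by positivity, min_le_right _ _⟩, fun t ht => ?_⟩
    have htI : t ∈ Icc 0 (π / 2) := ⟨ht.1.le, ht.2.trans (min_le_right _ _)⟩
    have hmono := strictMonoOn_wronskian H₁ H₂ hc le_rfl htI.2 (fun q hq => by
      have hq' : q ∈ Icc 0 (min (ε / 2) (π / 2)) := ⟨hq.1.le, hq.2.le.trans ht.2⟩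
      obtain ⟨h1, h2⟩ := hsmall q hq'
      have hqI : q ∈ Icc 0 (π / 2) := ⟨hq'.1, hq'.2.trans (min_le_right _ _)⟩
      obtain ⟨r₁, hr₁, e1, -⟩ := A₁.polar q hqI
      obtain ⟨r₂, hr₂, e2, -⟩ := A₂.polar q hqI
      rw [abs_lt] at h1 h2
      have c1 : 0 < cos (θ₁ q) := cos_pos_of_mem_Ioo ⟨by linarith, by linarith⟩
      have c2 : 0 < cos (θ₂ q) := cos_pos_of_mem_Ioo ⟨by linarith, by linarith⟩
      rw [e1, e2]
      positivity) (left_mem_Icc.2 ht.1.le) (right_mem_Icc.2 ht.1.le) ht.1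
    obtain ⟨r, hr, er⟩ := A₁.wronskian A₂ htI
    simp only [H₁.v_zero, H₂.v_zero, mul_zero, sub_zero, er] at hmono
    have hsin : 0 < sin (θ₂ t - θ₁ t) := pos_of_mul_pos_right hmono hr.le
    obtain ⟨h1, h2⟩ := hsmall t (Ioc_subset_Icc_self ht)
    rw [abs_lt] at h1 h2
    by_contra! hneg
    exact absurd (sin_nonpos_of_nonpos_of_neg_pi_le hneg (by linarith)) (not_le.2 hsin)
  intro t₁ ht₁
  by_contra! hcon
  have hδt : δ < t₁ := by
    by_contra! h
    have := hδ' t₁ ⟨ht₁.1, h⟩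
    linarith
  have hsub : Icc δ t₁ ⊆ Icc 0 (π / 2) := Icc_subset_Icc hδ.1.le ht₁.2
  have hΔδ := hδ' δ ⟨hδ.1, le_rfl⟩
  -- the first zero of the difference
  obtain ⟨t₀, ht₀, hmin⟩ : ∃ t₀, IsLeast (Icc δ t₁ ∩ (fun t => θ₂ t - θ₁ t) ⁻¹' {0}) t₀ := by
    refine IsCompact.exists_isLeast ?_ ?_
    · exact isCompact_Icc.of_isClosed_subset
        ((hΔc.mono hsub).preimage_isClosed_of_isClosed isClosed_Icc isClosed_singleton)
        inter_subset_left
    · obtain ⟨t, ht, h⟩ := intermediate_value_Icc' hδt.le (hΔc.mono hsub)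
        (show (0 : ℝ) ∈ Icc _ _ from ⟨by linarith, hΔδ.le⟩)
      exact ⟨t, ht, h⟩
  have hz : θ₂ t₀ - θ₁ t₀ = 0 := ht₀.2
  have ht₀I : t₀ ∈ Ioc 0 (π / 2) := ⟨hδ.1.trans_le ht₀.1.1, ht₀.1.2.trans ht₁.2⟩
  have ht₀I' := Ioc_subset_Icc_self ht₀I
  have hpos : ∀ t ∈ Ioo 0 t₀, 0 < θ₂ t - θ₁ t := by
    intro t ht
    rcases le_or_gt t δ with h | h
    · exact hδ' t ⟨ht.1, h⟩
    · have hsub2 : Icc δ t ⊆ Icc δ t₁ := Icc_subset_Icc_right (ht.2.le.trans ht₀.1.2)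
      have := lt_of_forall_ne (θ := fun t => -(θ₂ t - θ₁ t)) (c := 0) h.le
        ((hΔc.mono (hsub2.trans hsub)).neg) (by linarith) (fun q hq h0 => by
          have := hmin ⟨hsub2 hq, show θ₂ q - θ₁ q = 0 by linarith⟩
          linarith [hq.2, ht.2])
      linarith
  have hIcc : Icc 0 (π / 2) ∈ nhdsWithin t₀ (Iio t₀) :=
    Filter.mem_of_superset (Ioo_mem_nhdsLT ht₀I.1) fun t ht => ⟨ht.1.le, ht.2.le.trans ht₀I.2⟩
  have hleft := nhdsWithin_le_of_mem hIcc
  have hltpi : ∀ᶠ t in nhdsWithin t₀ (Iio t₀), θ₂ t - θ₁ t < π := by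
    have h1 : Filter.Tendsto (fun t => θ₂ t - θ₁ t) (nhdsWithin t₀ (Iio t₀))
        (nhds (θ₂ t₀ - θ₁ t₀)) := (hΔc t₀ ht₀I').tendsto.mono_left hleft
    rw [hz] at h1
    exact h1.eventually (gt_mem_nhds hpi)
  have hprod : ∀ᶠ t in nhdsWithin t₀ (Iio t₀), 0 < w₁ t * w₂ t := by
    obtain ⟨r₁, hr₁, e1, e1'⟩ := A₁.polar t₀ ht₀I'
    obtain ⟨r₂, hr₂, e2, e2'⟩ := A₂.polar t₀ ht₀I'
    have hθ : θ₂ t₀ = θ₁ t₀ := by linarith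
    rw [hθ] at e2 e2'
    by_cases hcos : cos (θ₁ t₀) = 0
    · have hsin : 0 < sin (θ₁ t₀) ^ 2 := by
        have := sin_sq_add_cos_sq (θ₁ t₀)
        rw [hcos] at this
        nlinarith
      have hv : 0 < v₁ t₀ * v₂ t₀ := by
        have : v₁ t₀ * v₂ t₀ = r₁ * r₂ * sin (θ₁ t₀) ^ 2 := by rw [e1', e2']; ring
        rw [this]
        positivity
      have h1 := H₁.eventually_mul_neg ht₀I (by rw [e1, hcos, mul_zero]) (left_ne_zero_of_mul hv.ne')
      have h2 := H₂.eventually_mul_neg ht₀I (by rw [e2, hcos, mul_zero])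
        (right_ne_zero_of_mul hv.ne')
      filter_upwards [h1, h2] with t h1 h2
      have h3 := mul_pos_of_neg_of_neg h1 h2
      rw [mul_mul_mul_comm] at h3
      exact pos_of_mul_pos_left h3 hv.le
    · have h1 : Filter.Tendsto (fun t => w₁ t * w₂ t) (nhdsWithin t₀ (Iio t₀))
          (nhds (w₁ t₀ * w₂ t₀)) :=
        ((H₁.u_cont t₀ ht₀I').mul (H₂.u_cont t₀ ht₀I')).tendsto.mono_left hleft
      refine h1.eventually (lt_mem_nhds ?_)
      have : w₁ t₀ * w₂ t₀ = r₁ * r₂ * cos (θ₁ t₀) ^ 2 := by rw [e1, e2]; ring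
      rw [this]
      positivity
  obtain ⟨l, hl, hl'⟩ := mem_nhdsLT_iff_exists_Ioo_subset.1
    (Filter.inter_mem (Filter.inter_mem hltpi hprod) (Ioo_mem_nhdsLT ht₀I.1))
  obtain ⟨t, ht⟩ := exists_between (mem_Iio.1 hl)
  have ht0 := hl' ht
  have hmono := strictMonoOn_wronskian H₁ H₂ hc ht0.2.1.le ht₀I.2
    (fun q hq => (hl' ⟨ht.1.trans hq.1, hq.2⟩).1.2) (left_mem_Icc.2 ht.2.le)
    (right_mem_Icc.2 ht.2.le) ht.2
  obtain ⟨r, hr, er⟩ := A₁.wronskian A₂ ht₀I'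
  obtain ⟨r', hr', er'⟩ := A₁.wronskian A₂ (t := t) ⟨ht0.2.1.le, ht.2.le.trans ht₀I.2⟩
  simp only [er, er', hz, sin_zero, mul_zero] at hmono
  have hsin := sin_pos_of_pos_of_lt_pi (hpos t ht0.2) ht0.1.1
  exact absurd hmono (not_lt.2 (by positivity))

end Comparison

/-! ### Even zonal eigenfunctions -/

theorem exists_even_gegenbauer (d j : ℕ) : ∃ g g' g'' : ℝ → ℝ, (∀ x, HasDerivAt g (g' x) x) ∧
    (∀ x, HasDerivAt g' (g'' x) x) ∧ g 0 = 1 ∧ g' 0 = 0 ∧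
    ∀ x, (1 - x ^ 2) * g'' x - (d + 1) * x * g' x + 2 * j * (2 * j + d) * g x = 0 := by
  have key : ∀ k : ℕ, ∃ a : ℝ, ∃ g g' g'' : ℝ → ℝ, (∀ x, HasDerivAt g (g' x) x) ∧
      (∀ x, HasDerivAt g' (g'' x) x) ∧ g 0 = 1 ∧ g' 0 = 0 ∧
      ∀ x, (1 - x ^ 2) * g'' x - (d + 1) * x * g' x + 2 * j * (2 * j + d) * g x
        = a * (2 * j * (2 * j + d) - 2 * k * (2 * k + d)) * x ^ (2 * k) := by
    intro k
    induction k with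
    | zero =>
      exact ⟨1, fun _ => 1, fun _ => 0, fun _ => 0, fun x => hasDerivAt_const x 1,
        fun x => hasDerivAt_const x 0, rfl, rfl, fun x => by simp⟩
    | succ k ih =>
      obtain ⟨a, g, g', g'', h1, h2, h3, h4, h5⟩ := ih
      set b : ℝ := -(a * (2 * j * (2 * j + d) - 2 * k * (2 * k + d))) / ((2 * k + 2) * (2 * k + 1))
        with hb
      have hb' : b * ((2 * k + 2) * (2 * k + 1))
          = -(a * (2 * j * (2 * j + d) - 2 * k * (2 * k + d))) := by
        rw [hb]
        field_simp
      refine ⟨b, fun x => g x + b * x ^ (2 * k + 2), fun x => g' x + b * (2 * k + 2) * x ^ (2 * k + 1),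
        fun x => g'' x + b * (2 * k + 2) * (2 * k + 1) * x ^ (2 * k), fun x => ?_, fun x => ?_,
        by simp [h3], by simp [h4], fun x => ?_⟩
      · refine ((h1 x).add ((hasDerivAt_pow (2 * k + 2) x).const_mul b)).congr_deriv ?_
        push_cast
        ring
      · refine ((h2 x).add ((hasDerivAt_pow (2 * k + 1) x).const_mul (b * (2 * k + 2)))).congr_deriv ?_
        push_cast
        ring
      · have := h5 x
        push_cast
        linear_combination this + x ^ (2 * k) * hb'
  obtain ⟨a, g, g', g'', h1, h2, h3, h4, h5⟩ := key j
  exact ⟨g, g', g'', h1, h2, h3, h4, fun x => by rw [h5 x]; ring⟩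

theorem exists_even_eigenfunction (d j : ℕ) : ∃ w v : ℝ → ℝ,
    IsRadialSol d (fun t => 2 * j * (2 * j + d) * w t) w v ∧ w 0 = 1 ∧ v (π / 2) = 0 := by
  obtain ⟨g, g', g'', h1, h2, h3, h4, h5⟩ := exists_even_gegenbauer d j
  have hg : ∀ t, HasDerivAt (fun t => g (cos t)) (-(sin t) * g' (cos t)) t := fun t =>
    ((h1 (cos t)).comp t (hasDerivAt_cos t)).congr_deriv (by ring)
  have hg' : ∀ t, HasDerivAt (fun t => g' (cos t)) (-(sin t) * g'' (cos t)) t := fun t =>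
    ((h2 (cos t)).comp t (hasDerivAt_cos t)).congr_deriv (by ring)
  have hv : ∀ t, HasDerivAt (fun t => -(sin t ^ (d + 1) * g' (cos t)))
      (-(sin t ^ d * (2 * j * (2 * j + d) * g (cos t)))) t := fun t => by
    refine (((hasDerivAt_sin t).pow (d + 1)).mul (hg' t)).neg.congr_deriv ?_
    have e1 := h5 (cos t)
    have e2 := sin_sq t
    rw [← e2] at e1
    simp only [Pi.pow_apply]
    push_cast
    linear_combination (sin t) ^ d * e1
  have H : IsRadialSol d (fun t => 2 * j * (2 * j + d) * g (cos t)) (fun t => g (cos t))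
      (fun t => -(sin t ^ (d + 1) * g' (cos t))) :=
    ⟨⟨fun t _ => (hv t).continuousAt.continuousWithinAt, by simp, fun t _ => hv t⟩,
      fun t _ => (hg t).continuousAt.continuousWithinAt, fun t ht => (hg t).congr_deriv (by
        have := (sin_pos_of_mem_hemisphere (Ioo_subset_Ioc_self ht)).ne'
        rw [eq_div_iff (pow_ne_zero d this)]
        ring)⟩
  have hne : g 1 ≠ 0 := by
    intro h0
    have := (H.unique (L := 2 * j * (2 * j + d)) (by positivity) (IsRadialSol.const d 0)
      (by simpa using h0) (fun t _ => by
        rw [sub_zero, sub_zero, abs_mul, abs_of_nonneg (by positivity)])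
      (π / 2) (right_mem_Icc.2 (by positivity))).1
    simp [h3] at this
  refine ⟨_, _, (H.affine (g 1)⁻¹ 0).congr fun t _ => ?_, ?_, ?_⟩
  · ring
  · simp [hne]
  · simp [h4]

theorem exists_even_eigenfunction_pruferAngle (d j : ℕ) : ∃ w v θ : ℝ → ℝ,
    IsRadialSol d (fun t => 2 * j * (2 * j + d) * w t) w v ∧ IsPruferAngle w v θ ∧
      v (π / 2) = 0 ∧ j * π ≤ θ (π / 2) := by
  have hmem : π / 2 ∈ Ioc 0 (π / 2) := ⟨by positivity, le_rfl⟩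
  have angle : ∀ (j : ℕ) (w v : ℝ → ℝ), IsRadialSol d (fun t => 2 * j * (2 * j + d) * w t) w v →
      w 0 = 1 → ∃ θ, IsPruferAngle w v θ := fun j w v H h0 =>
    H.exists_pruferAngle (L := 2 * j * (2 * j + d)) (by positivity)
      (fun t _ => by rw [abs_mul, abs_of_nonneg (by positivity)]) h0
  induction j with
  | zero =>
    refine ⟨fun _ => 1, fun _ => 0, fun _ => 0, (IsRadialSol.const d 1).congr (by simp),
      ⟨continuousOn_const, rfl, fun _ _ => ⟨1, one_pos, by simp, by simp⟩⟩, rfl, by simp⟩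
  | succ j ih =>
    obtain ⟨w, v, θ, H, A, -, hθ⟩ := ih
    obtain ⟨w', v', H', h0, hv'⟩ := exists_even_eigenfunction d (j + 1)
    obtain ⟨θ', A'⟩ := angle (j + 1) w' v' H' h0
    refine ⟨w', v', θ', H', A', hv', ?_⟩
    have hlt := IsPruferAngle.lt H H' A A' (fun t _ => by push_cast; nlinarith) (π / 2) hmem
    obtain ⟨r, hr, -, h2⟩ := A'.polar (π / 2) (Ioc_subset_Icc_self hmem)
    have hsin : sin (θ' (π / 2)) = 0 := by
      rw [hv'] at h2
      rcases mul_eq_zero.1 (neg_eq_zero.1 h2.symm) with h | h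
      · exact absurd h hr.ne'
      · exact h
    obtain ⟨k, hk⟩ := sin_eq_zero_iff.1 hsin
    rw [← hk] at hlt ⊢
    have h3 : (j : ℝ) < k := lt_of_mul_lt_mul_right (hθ.trans_lt hlt) pi_pos.le
    have h4 : (j : ℤ) + 1 ≤ k := by
      have : (j : ℤ) < k := by exact_mod_cast h3
      omega
    have h5 : ((j + 1 : ℕ) : ℝ) ≤ k := by exact_mod_cast h4
    exact mul_le_mul_of_nonneg_right h5 pi_pos.le

theorem IsPruferAngle.nat_mul_pi_lt {d n : ℕ} {μ : ℝ} (hμ : 2 * n * (2 * n + d) < μ)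
    {w v θ : ℝ → ℝ} (H : IsRadialSol d (fun t => μ * w t) w v) (A : IsPruferAngle w v θ) :
    n * π < θ (π / 2) := by
  obtain ⟨w', v', θ', H', A', -, hθ⟩ := exists_even_eigenfunction_pruferAngle d n
  exact hθ.trans_lt (IsPruferAngle.lt H' H A' A (fun _ _ => hμ) (π / 2) ⟨by positivity, le_rfl⟩)

/-! ### The nonlinearity -/

/-- The nonlinearity `λ (x^(p-1) - x)` of the Yamabe equation. -/
noncomputable def yamabeForce (p lam x : ℝ) : ℝ := lam * (x ^ (p - 1) - x)

/-- The primitive of `yamabeForce` vanishing at zero. -/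
noncomputable def yamabePotential (p lam x : ℝ) : ℝ := lam * (x ^ p / p - x ^ 2 / 2)

section Nonlinearity

variable {p lam : ℝ}

theorem rpow_sub_one_eq {x : ℝ} (hx : 0 < x) : x ^ (p - 1) = x ^ (p - 2) * x := by
  rw [show p - 1 = p - 2 + 1 by ring, rpow_add_one hx.ne']

theorem rpow_eq_mul_sq {x : ℝ} (hx : 0 < x) : x ^ p = x ^ (p - 2) * x ^ 2 := by
  rw [← rpow_natCast x 2, ← rpow_add hx]
  congr 1
  push_cast
  ring

theorem yamabeForce_eq {x : ℝ} (hx : 0 < x) :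
    yamabeForce p lam x = lam * x * (x ^ (p - 2) - 1) := by
  rw [yamabeForce, rpow_sub_one_eq hx]
  ring

theorem continuous_yamabeForce (hp : 2 < p) : Continuous (yamabeForce p lam) :=
  ((Real.continuous_rpow_const (by linarith)).sub continuous_id).const_mul lam

theorem hasDerivAt_yamabePotential (hp : 2 < p) (x : ℝ) :
    HasDerivAt (yamabePotential p lam) (yamabeForce p lam x) x := by
  have h1 := (Real.hasDerivAt_rpow_const (x := x) (p := p) (Or.inr (by linarith))).div_const p
  have h2 := (hasDerivAt_pow 2 x).div_const 2
  refine ((h1.sub h2).const_mul lam).congr_deriv ?_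
  have : p ≠ 0 := by linarith
  rw [yamabeForce]
  field_simp
  push_cast
  ring

theorem yamabeForce_pos (hp : 2 < p) (hlam : 0 < lam) {x : ℝ} (hx : 1 < x) :
    0 < yamabeForce p lam x := by
  rw [yamabeForce_eq (by linarith)]
  have := one_lt_rpow hx (show 0 < p - 2 by linarith)
  have : 0 < x ^ (p - 2) - 1 := by linarith
  have : 0 < x := by linarith
  positivity

theorem yamabeForce_neg (hp : 2 < p) (hlam : 0 < lam) {x : ℝ} (hx : 0 < x) (hx1 : x < 1) :
    yamabeForce p lam x < 0 := by
  rw [yamabeForce_eq hx]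
  have := rpow_lt_one hx.le hx1 (show 0 < p - 2 by linarith)
  have : 0 < 1 - x ^ (p - 2) := by linarith
  have : 0 < lam * x * (1 - x ^ (p - 2)) := by positivity
  linarith

theorem yamabePotential_neg (hp : 2 < p) (hlam : 0 < lam) {x : ℝ} (hx : 0 < x) (hx1 : x ≤ 1) :
    yamabePotential p lam x < 0 := by
  rw [yamabePotential, rpow_eq_mul_sq hx]
  have h1 := rpow_le_one hx.le hx1 (show 0 ≤ p - 2 by linarith)
  have h2 : x ^ (p - 2) * x ^ 2 / p < x ^ 2 / 2 := by
    rw [div_lt_div_iff₀ (by linarith) two_pos]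
    have : 0 < x ^ 2 := by positivity
    nlinarith
  exact mul_neg_of_pos_of_neg hlam (by linarith)

theorem abs_yamabeForce_le (hp : 2 < p) (hlam : 0 < lam) {x α : ℝ} (hx : 0 < x) (hxα : x ≤ α)
    (hα : 1 ≤ α) : |yamabeForce p lam x| ≤ lam * (α ^ (p - 2) * α) := by
  rw [yamabeForce_eq hx, abs_mul, abs_of_pos (by positivity)]
  have h1 := rpow_le_rpow hx.le hxα (show 0 ≤ p - 2 by linarith)
  have h2 := rpow_nonneg hx.le (p - 2)
  have h3 := one_le_rpow hα (show 0 ≤ p - 2 by linarith)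
  have h4 : |x ^ (p - 2) - 1| ≤ α ^ (p - 2) := by
    rw [abs_le]
    constructor <;> linarith
  calc lam * x * |x ^ (p - 2) - 1| ≤ lam * α * α ^ (p - 2) := by gcongr
    _ = _ := by ring

theorem exists_le_rpow (hp : 2 < p) (A : ℝ) : ∃ X ≥ 1, ∀ x ≥ X, A ≤ x ^ (p - 2) := by
  have := ((tendsto_rpow_atTop (show 0 < p - 2 by linarith)).eventually_ge_atTop A).and
    (Filter.eventually_ge_atTop 1)
  obtain ⟨X, hX⟩ := Filter.eventually_atTop.1 this
  exact ⟨X, (hX X le_rfl).2, fun x hx => (hX x hx).1⟩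

end Nonlinearity

/-! ### Large initial values -/

theorem half_le_sin {x : ℝ} (h0 : 0 < x) (h1 : x ≤ 1) : x / 2 ≤ sin x := by
  have h2 := sin_gt_sub_cube h0
  have h3 : x ^ 3 ≤ x := by
    simpa using pow_le_pow_of_le_one h0.le h1 (show 1 ≤ 3 by norm_num)
  linarith

theorem hasDerivAt_sin_pow_succ_div (d : ℕ) (t : ℝ) :
    HasDerivAt (fun t => sin t ^ (d + 1) / (d + 1)) (sin t ^ d * cos t) t := by
  refine (((hasDerivAt_sin t).pow (d + 1)).div_const ((d : ℝ) + 1)).congr_deriv ?_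
  have : (d : ℝ) + 1 ≠ 0 := by positivity
  push_cast
  field_simp

/-- The Pohozaev function of a radial solution. -/
noncomputable def pohozaev (d : ℕ) (p lam : ℝ) (u v : ℝ → ℝ) (t : ℝ) : ℝ :=
  sin t ^ (d + 1) * ((v t / sin t ^ d) ^ 2 / 2 + yamabePotential p lam (u t))
    + ((d : ℝ) - 1) / 2 * (cos t * v t * u t)

section Pohozaev

variable {d : ℕ} {p lam : ℝ} {u v : ℝ → ℝ}

theorem hasDerivAt_pohozaev (hp : 2 < p)
    (H : IsRadialSol d (fun t => yamabeForce p lam (u t)) u v) {t : ℝ} (ht : t ∈ Ioo 0 (π / 2))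
    (hu : 0 < u t) :
    HasDerivAt (pohozaev d p lam u v)
      (sin t ^ d * cos t * (lam * (((d + 1) / p - (d - 1) / 2) * u t ^ p - u t ^ 2))
        - (d - 1) / 2 * (sin t * v t * u t)) t := by
  have hs := sin_pos_of_mem_hemisphere (Ioo_subset_Ioc_self ht)
  have h1 := (H.hasDerivAt_deriv ht).pow 2
  have h2 := (hasDerivAt_yamabePotential (lam := lam) hp (u t)).comp t (H.u_deriv t ht)
  have h3 := ((hasDerivAt_sin t).pow (d + 1)).mul ((h1.div_const 2).add h2)
  have h4 := (((hasDerivAt_cos t).mul (H.v_deriv t ht)).mul (H.u_deriv t ht)).const_mul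
    (((d : ℝ) - 1) / 2)
  refine (h3.add h4).congr_deriv ?_
  obtain ⟨z, hz⟩ : ∃ z, v t = sin t ^ d * z := ⟨v t / sin t ^ d, by field_simp⟩
  have hp0 : p ≠ 0 := by linarith
  have e1 : v t / sin t ^ d = z := by rw [hz]; field_simp
  have e2 : u t ^ (p - 1) * u t = u t ^ p := by
    rw [← rpow_add_one hu.ne']; congr 1; ring
  simp only [Pi.pow_apply, Pi.add_apply, Function.comp, e1, Pi.mul_apply]
  rw [hz, yamabeForce, yamabePotential, ← e2]
  push_cast
  field_simp
  ring

theorem pohozaev_continuousOn (hp : 2 < p)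
    (H : IsRadialSol d (fun t => yamabeForce p lam (u t)) u v)
    (hz : ContinuousOn (fun t => v t / sin t ^ d) (Icc 0 (π / 2))) :
    ContinuousOn (pohozaev d p lam u v) (Icc 0 (π / 2)) := by
  have hF : Continuous (yamabePotential p lam) :=
    continuous_iff_continuousAt.2 fun x => (hasDerivAt_yamabePotential hp x).continuousAt
  refine ContinuousOn.add ?_ ?_
  · exact (continuous_sin.pow _).continuousOn.mul
      (((hz.pow 2).div_const 2).add (hF.comp_continuousOn H.u_cont))
  · exact continuousOn_const.mul ((continuous_cos.continuousOn.mul H.v_cont).mul H.u_cont)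

end Pohozaev

theorem exists_pohozaev_scale {d : ℕ} {p lam : ℝ} (hp : 2 < p) (hlam : 0 < lam)
    (hsub : ((d : ℝ) + 1) * (p - 2) < 2 * p) (A : ℝ) : ∃ B ≥ 1, ∀ α ≥ B, ∃ τ > 0, τ ≤ 1 / 2 ∧
      lam * (α ^ (p - 2) * α) * τ ^ 2 = α ∧ A ≤ α ^ p * τ ^ (d + 1) := by
  obtain ⟨X, hX1, hX⟩ := exists_le_rpow hp (4 / lam)
  set e : ℝ := p - (p - 2) / 2 * (d + 1) with he
  have he0 : 0 < e := by rw [he]; linarith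
  obtain ⟨Y, hY⟩ := Filter.eventually_atTop.1
    ((tendsto_rpow_atTop he0).eventually_ge_atTop (A * √lam ^ (d + 1)))
  refine ⟨max X Y, hX1.trans (le_max_left _ _), fun α hα => ?_⟩
  have hαX := (le_max_left _ _).trans hα
  have hα0 : 0 < α := by linarith
  have hq : 0 < α ^ (p - 2) := rpow_pos_of_pos hα0 _
  have hsl : 0 < √lam := sqrt_pos.2 hlam
  have hq2 : (α ^ ((p - 2) / 2)) ^ 2 = α ^ (p - 2) := by
    rw [← rpow_natCast, ← rpow_mul hα0.le]
    congr 1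
    push_cast
    ring
  have hq' : 0 < α ^ ((p - 2) / 2) := rpow_pos_of_pos hα0 _
  have hsq : (√lam * α ^ ((p - 2) / 2)) ^ 2 = lam * α ^ (p - 2) := by
    rw [mul_pow, sq_sqrt hlam.le, hq2]
  refine ⟨(√lam * α ^ ((p - 2) / 2))⁻¹, by positivity, ?_, ?_, ?_⟩
  · have h1 := hX α hαX
    rw [div_le_iff₀ hlam, mul_comm, ← hsq] at h1
    rw [one_div]
    refine inv_anti₀ two_pos (le_of_sq_le_sq ?_ (by positivity))
    linarith
  · rw [inv_pow, hsq]
    field_simp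
  · have h1 := hY α ((le_max_right _ _).trans hα)
    have h2 : α ^ p = α ^ e * (α ^ ((p - 2) / 2)) ^ (d + 1) := by
      rw [← rpow_natCast, ← rpow_mul hα0.le, ← rpow_add hα0]
      congr 1
      rw [he]
      push_cast
      ring
    rw [h2, inv_pow, mul_pow, mul_inv, mul_mul_mul_comm, mul_comm (_ ^ _ : ℝ) (_⁻¹)]
    have h3 : (α ^ ((p - 2) / 2)) ^ (d + 1) * ((α ^ ((p - 2) / 2)) ^ (d + 1))⁻¹ = 1 :=
      mul_inv_cancel₀ (by positivity)
    rw [h3, mul_one, inv_mul_eq_div, le_div_iff₀ (by positivity)]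
    exact h1

section Pohozaev

variable {d : ℕ} {p lam : ℝ} {u v : ℝ → ℝ}

theorem pohozaev_sub_ge (hd : d ≠ 0) (hp : 2 < p)
    (H : IsRadialSol d (fun t => yamabeForce p lam (u t)) u v)
    (hz : ContinuousOn (fun t => v t / sin t ^ d) (Icc 0 (π / 2))) {a b κ : ℝ} (ha : 0 ≤ a)
    (hab : a ≤ b) (hb : b ≤ π / 2) (hu : ∀ t ∈ Ioo a b, 0 < u t) (hv : ∀ t ∈ Ioo a b, v t ≤ 0)
    (hκ : ∀ t ∈ Ioo a b, κ ≤ lam * (((d + 1) / p - (d - 1) / 2) * u t ^ p - u t ^ 2)) :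
    κ * (sin b ^ (d + 1) / (d + 1)) - κ * (sin a ^ (d + 1) / (d + 1))
      ≤ pohozaev d p lam u v b - pohozaev d p lam u v a := by
  have hsub' : Ioo a b ⊆ Ioo 0 (π / 2) := Ioo_subset_Ioo ha hb
  have := monotoneOn_Icc_of_hasDerivAt
    (((pohozaev_continuousOn hp H hz).mono (Icc_subset_Icc ha hb)).sub
      (f := pohozaev d p lam u v) (g := fun t => κ * (sin t ^ (d + 1) / (d + 1)))
      (Continuous.continuousOn (by fun_prop)))
    (fun t ht => (hasDerivAt_pohozaev hp H (hsub' ht) (hu t ht)).sub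
      ((hasDerivAt_sin_pow_succ_div d t).const_mul κ))
    (fun t ht => by
      have hs := sin_pos_of_mem_hemisphere (Ioo_subset_Ioc_self (hsub' ht))
      have hc := cos_nonneg_of_mem_hemisphere (Ioo_subset_Icc_self (hsub' ht))
      have hd1 : (1 : ℝ) ≤ d := by exact_mod_cast Nat.one_le_iff_ne_zero.2 hd
      have h1 : 0 ≤ ((d : ℝ) - 1) / 2 * (sin t * (-v t) * u t) :=
        mul_nonneg (by linarith) (mul_nonneg (mul_nonneg hs.le (by linarith [hv t ht])) (hu t ht).le)
      have h2 := mul_le_mul_of_nonneg_left (hκ t ht) (show 0 ≤ sin t ^ d * cos t by positivity)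
      linarith)
    (left_mem_Icc.2 hab) (right_mem_Icc.2 hab) hab
  simp only [Pi.sub_apply] at this
  linarith

/-- The flux of a positive solution that is large at the pole cannot vanish while the Pohozaev
function is positive. -/
theorem flux_ne_zero_of_pohozaev_pos (hp : 2 < p) (hlam : 0 < lam)
    (H : IsRadialSol d (fun t => yamabeForce p lam (u t)) u v) (hu : ∀ t ∈ Icc 0 (π / 2), 0 < u t)
    {t : ℝ} (ht : t ∈ Ioc 0 (π / 2)) (hv : ∀ q ∈ Ioo 0 t, v q < 0)
    (hP : 0 < pohozaev d p lam u v t) : v t ≠ 0 := by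
  intro h0
  have hsub : Icc 0 t ⊆ Icc 0 (π / 2) := Icc_subset_Icc_right ht.2
  have hsub' : Ioo 0 t ⊆ Ioo 0 (π / 2) := Ioo_subset_Ioo_right ht.2
  have hs := sin_pos_of_mem_hemisphere ht
  rw [pohozaev, h0] at hP
  simp only [zero_div, mul_zero, zero_mul, add_zero, ne_eq, OfNat.ofNat_ne_zero,
    not_false_eq_true, zero_pow, zero_add] at hP
  have hF := pos_of_mul_pos_right hP (pow_pos hs _).le
  have hut : 1 < u t := by
    by_contra! hle
    exact absurd (yamabePotential_neg hp hlam (hu t (Ioc_subset_Icc_self ht)) hle)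
      (not_lt.2 hF.le)
  have hanti := antitoneOn_Icc_of_hasDerivAt (H.u_cont.mono hsub)
    (fun q hq => H.u_deriv q (hsub' hq)) (fun q hq => div_nonpos_of_nonpos_of_nonneg (hv q hq).le
      (pow_nonneg (sin_nonneg_of_mem_hemisphere (Ioo_subset_Icc_self (hsub' hq))) d))
  have hva := strictAntiOn_Icc_of_hasDerivAt (H.v_cont.mono hsub)
    (fun q hq => H.v_deriv q (hsub' hq)) (fun q hq => by
      have h1 := hanti (Ioo_subset_Icc_self hq) (right_mem_Icc.2 ht.1.le) hq.2.le
      have h2 := yamabeForce_pos hp hlam (hut.trans_le h1)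
      have h3 := sin_pos_of_mem_hemisphere (Ioo_subset_Ioc_self (hsub' hq))
      have : 0 < sin q ^ d * yamabeForce p lam (u q) := by positivity
      linarith)
    (left_mem_Icc.2 ht.1.le) (right_mem_Icc.2 ht.1.le) ht.1
  rw [h0, H.v_zero] at hva
  exact lt_irrefl _ hva

end Pohozaev

theorem exists_bound_of_antitone (d : ℕ) {p lam : ℝ} (hp : 2 < p) (hlam : 0 < lam) :
    ∃ M ≥ 1, ∀ u v : ℝ → ℝ, IsRadialSol d (fun t => yamabeForce p lam (u t)) u v →
      (∀ t ∈ Icc 0 (π / 2), 0 < u t) → AntitoneOn u (Icc 0 (π / 2)) → u (π / 4) ≤ M := by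
  have hpi := pi_pos
  obtain ⟨X, hX1, hX⟩ := exists_le_rpow hp ((d + 2 + lam) / lam)
  set k : ℝ → ℝ := fun x => (d + 1) * x - yamabeForce p lam x with hk
  have hkx : ∀ x > 0, k x = x * (d + 1 + lam - lam * x ^ (p - 2)) := fun x hx => by
    simp only [hk, yamabeForce_eq hx]
    ring
  have hk1 : ∀ x ≥ X, k x ≤ -x := by
    intro x hx
    rw [hkx x (by linarith)]
    have := hX x hx
    rw [div_le_iff₀ hlam] at this
    nlinarith
  set C : ℝ := (d + 1 + lam) * X with hC
  have hC0 : 0 ≤ C := by positivity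
  have hk2 : ∀ x > 0, k x ≤ C := by
    intro x hx
    rcases le_or_gt X x with h | h
    · have := hk1 x h
      linarith
    · rw [hkx x hx, hC]
      have h1 : 0 ≤ x * (lam * x ^ (p - 2)) := by positivity
      have h2 : x * (d + 1 + lam) ≤ (d + 1 + lam) * X := by
        rw [mul_comm]
        gcongr
      linarith
  have hσ : 0 < sin (π / 4) ^ (d + 1) := pow_pos (sin_pos_of_pos_of_lt_pi (by linarith)
    (by linarith)) _
  set σ : ℝ := sin (π / 4) ^ (d + 1) with hσdef
  refine ⟨max X (C / σ + 1), hX1.trans (le_max_left _ _), fun u v H hu hanti => ?_⟩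
  by_contra! hM
  have step : ∀ a b κ : ℝ, 0 ≤ a → a ≤ b → b ≤ π / 2 → (∀ t ∈ Ioo a b, k (u t) ≤ κ) →
      (cos b * v b + sin b ^ (d + 1) * u b) - κ * (sin b ^ (d + 1) / (d + 1)) ≤
        (cos a * v a + sin a ^ (d + 1) * u a) - κ * (sin a ^ (d + 1) / (d + 1)) := by
    intro a b κ ha hab hb hκ
    have hsub : Icc a b ⊆ Icc 0 (π / 2) := Icc_subset_Icc ha hb
    refine antitoneOn_Icc_of_hasDerivAt
      (f := fun t => (cos t * v t + sin t ^ (d + 1) * u t) - κ * (sin t ^ (d + 1) / (d + 1)))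
      (f' := fun t => sin t ^ d * cos t * (k (u t) - κ))
      (((continuous_cos.continuousOn.mul (H.v_cont.mono hsub)).add
        ((continuous_sin.pow _).continuousOn.mul (H.u_cont.mono hsub))).sub
        (Continuous.continuousOn (by fun_prop))) (fun t ht => ?_) (fun t ht => ?_)
      (left_mem_Icc.2 hab) (right_mem_Icc.2 hab) hab
    · have ht' := Ioo_subset_Ioo ha hb ht
      have hs := sin_pos_of_mem_hemisphere (Ioo_subset_Ioc_self ht')
      have h1 := ((hasDerivAt_cos t).mul (H.v_deriv t ht')).add
        (((hasDerivAt_sin t).pow (d + 1)).mul (H.u_deriv t ht'))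
      refine (h1.sub ((hasDerivAt_sin_pow_succ_div d t).const_mul κ)).congr_deriv ?_
      simp only [Pi.pow_apply, hk]
      push_cast
      field_simp
      ring
    · have ht' := Ioo_subset_Ioo ha hb ht
      have hs := sin_pos_of_mem_hemisphere (Ioo_subset_Ioc_self ht')
      have hc := cos_nonneg_of_mem_hemisphere (Ioo_subset_Icc_self ht')
      exact mul_nonpos_of_nonneg_of_nonpos (by positivity) (sub_nonpos.2 (hκ t ht))
  have hmem : π / 4 ∈ Icc 0 (π / 2) := ⟨by linarith, by linarith⟩
  have h1 := step 0 (π / 4) (-(C / σ + 1)) le_rfl hmem.1 hmem.2 (fun t ht => by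
    have h2 : u (π / 4) ≤ u t := hanti ⟨ht.1.le, ht.2.le.trans hmem.2⟩ hmem ht.2.le
    have h3 := hk1 (u t) (by linarith [le_max_left X (C / σ + 1)])
    linarith [le_max_right X (C / σ + 1)])
  have h2 := step (π / 4) (π / 2) C hmem.1 hmem.2 le_rfl
    (fun t ht => hk2 _ (hu t ⟨hmem.1.trans ht.1.le, ht.2.le⟩))
  have h3 := hu (π / 2) (right_mem_Icc.2 (by positivity))
  have hd1 : (0 : ℝ) < d + 1 := by positivity
  rw [← hσdef] at h1 h2
  simp only [sin_zero, cos_zero, H.v_zero, sin_pi_div_two, cos_pi_div_two, one_pow, zero_mul,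
    mul_zero, zero_add, one_mul, ne_eq, Nat.add_eq_zero_iff, one_ne_zero, and_false,
    not_false_eq_true, zero_pow, zero_div, sub_zero] at h1 h2
  have h4 : (C / σ + 1) * (σ / (d + 1)) = C * (1 / (d + 1)) + σ / (d + 1) := by
    field_simp
  have h5 : 0 ≤ C * (σ / (d + 1)) := by positivity
  have h6 : 0 < σ / (d + 1) := by positivity
  linarith

/-- In the subcritical range no positive solution on the hemisphere has a large initial value. -/
theorem exists_no_large_positive_sol {d : ℕ} (hd : d ≠ 0) {p lam : ℝ} (hp : 2 < p)
    (hlam : 0 < lam) (hsub : ((d : ℝ) + 1) * (p - 2) < 2 * p) :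
    ∃ B ≥ 1, ∀ u v : ℝ → ℝ, IsRadialSol d (fun t => yamabeForce p lam (u t)) u v →
      (∀ t ∈ Icc 0 (π / 2), 0 < u t) → (∀ t ∈ Icc 0 (π / 2), u t ≤ u 0) → u 0 < B := by
  have hpi := pi_gt_three
  obtain ⟨M, hM1, hM⟩ := exists_bound_of_antitone d hp hlam
  set δ : ℝ := (d + 1) / p - (d - 1) / 2 with hδ
  have hδ0 : 0 < δ := by
    rw [hδ, sub_pos, div_lt_div_iff₀ two_pos (by linarith)]
    linarith
  obtain ⟨X, hX1, hX⟩ := exists_le_rpow hp (2 / δ)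
  have hXδ : ∀ x ≥ X, x ^ 2 ≤ δ / 2 * x ^ p := by
    intro x hx
    have hx0 : 0 < x := by linarith
    have := hX x hx
    rw [div_le_iff₀ hδ0] at this
    rw [rpow_eq_mul_sq hx0]
    nlinarith [sq_nonneg x]
  have hC : ∀ x > 0, -(X ^ 2) ≤ δ * x ^ p - x ^ 2 := by
    intro x hx
    have hxp : 0 < x ^ p := rpow_pos_of_pos hx p
    rcases le_or_gt X x with h | h
    · have := hXδ x h
      nlinarith [sq_nonneg X, mul_pos hδ0 hxp]
    · have : x ^ 2 ≤ X ^ 2 := by gcongr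
      nlinarith [mul_pos hδ0 hxp]
  -- the level the Pohozaev function has to exceed
  set K : ℝ := lam * (M ^ p / p) + (4 * M / π) ^ 2 / 2 + 1 with hK
  have hK0 : 0 < K := by positivity
  set S : ℝ := K + lam * X ^ 2 / (d + 1) with hS
  obtain ⟨B, hB1, hB⟩ := exists_pohozaev_scale hp hlam hsub
    (S * (d + 1) * 2 ^ (d + 1) * 2 ^ p * 2 / (lam * δ))
  refine ⟨max B (2 * X + 1), hB1.trans (le_max_left _ _), fun u v H hu huα => ?_⟩
  by_contra! hα
  set α := u 0 with hαdef
  obtain ⟨τ, hτ0, hτ1, hτ2, hτA⟩ := hB α ((le_max_left _ _).trans hα)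
  have hαX : 2 * X + 1 ≤ α := (le_max_right _ _).trans hα
  have hα1 : 1 ≤ α := by linarith
  have hτI : τ ∈ Icc 0 (π / 2) := ⟨hτ0.le, by linarith⟩
  have hforce : ∀ t ∈ Icc 0 (π / 2), |yamabeForce p lam (u t)| ≤ lam * (α ^ (p - 2) * α) :=
    fun t ht => abs_yamabeForce_le hp hlam (hu t ht) (huα t ht) hα1
  have hz := H.continuousOn_deriv hd (fun t ht => hforce t (Ioo_subset_Icc_self ht))
  have hhalf : ∀ t ∈ Icc 0 τ, α / 2 ≤ u t := by
    intro t ht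
    have h1 := H.abs_u_sub_le_sq (fun t ht => hforce t (Ioo_subset_Icc_self ht))
      (t := t) ⟨ht.1, ht.2.trans hτI.2⟩
    have h2 : lam * (α ^ (p - 2) * α) * t ^ 2 ≤ α := by
      refine le_trans ?_ hτ2.le
      have := ht.1
      have : t ^ 2 ≤ τ ^ 2 := pow_le_pow_left₀ ht.1 ht.2 2
      have : 0 ≤ lam * (α ^ (p - 2) * α) := by positivity
      gcongr
    have := (abs_le.1 h1).1
    linarith
  have hvτ : ∀ t ∈ Ioc 0 τ, v t < 0 := by
    intro t ht
    have := strictAntiOn_Icc_of_hasDerivAt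
      (H.v_cont.mono (Icc_subset_Icc_right (ht.2.trans hτI.2)))
      (fun q hq => H.v_deriv q ⟨hq.1, hq.2.trans_le (ht.2.trans hτI.2)⟩) (fun q hq => by
        have hq' : q ∈ Ioc 0 (π / 2) := ⟨hq.1, (hq.2.le.trans ht.2).trans hτI.2⟩
        have h1 := hhalf q ⟨hq.1.le, hq.2.le.trans ht.2⟩
        have h3 := sin_pos_of_mem_hemisphere hq'
        have h2 := yamabeForce_pos (x := u q) hp hlam (by linarith)
        have : 0 < sin q ^ d * yamabeForce p lam (u q) := by positivity
        linarith)
      (left_mem_Icc.2 ht.1.le) (right_mem_Icc.2 ht.1.le) ht.1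
    rwa [H.v_zero] at this
  have hd1 : (0 : ℝ) < d + 1 := by positivity
  have hPτ : S ≤ pohozaev d p lam u v τ := by
    have h1 := pohozaev_sub_ge (κ := lam * (δ / 2 * (α / 2) ^ p)) hd hp H hz le_rfl hτ0.le hτI.2
      (fun t ht => hu t ⟨ht.1.le, ht.2.le.trans hτI.2⟩) (fun t ht => (hvτ t ⟨ht.1, ht.2.le⟩).le)
      (fun t ht => by
        have h2 := hhalf t (Ioo_subset_Icc_self ht)
        have h3 := hXδ (u t) (by linarith)
        have h4 : (α / 2) ^ p ≤ u t ^ p := rpow_le_rpow (by linarith) h2 (by linarith)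
        rw [← hδ]
        refine mul_le_mul_of_nonneg_left ?_ hlam.le
        nlinarith)
    have h0 : pohozaev d p lam u v 0 = 0 := by simp [pohozaev, H.v_zero]
    rw [h0] at h1
    simp only [sin_zero, ne_eq, Nat.add_eq_zero_iff, one_ne_zero, and_false, not_false_eq_true,
      zero_pow, zero_div, mul_zero, sub_zero] at h1
    refine le_trans ?_ h1
    have h5 := half_le_sin hτ0 (by linarith)
    rw [div_le_iff₀ (by positivity)] at hτA
    have h6 : S = S * (d + 1) * 2 ^ (d + 1) * 2 ^ p * 2 / (2 * 2 ^ p * 2 ^ (d + 1) * (d + 1)) := by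
      field_simp
    calc S ≤ α ^ p * τ ^ (d + 1) * (lam * δ) / (2 * 2 ^ p * 2 ^ (d + 1) * (d + 1)) := by
          rw [h6]
          gcongr
      _ = lam * (δ / 2 * (α / 2) ^ p) * ((τ / 2) ^ (d + 1) / (d + 1)) := by
          rw [div_rpow (by linarith) two_pos.le, div_pow]
          field_simp
      _ ≤ _ := by gcongr
  have hP : ∀ t ∈ Icc τ (π / 2), (∀ q ∈ Ioo 0 t, v q < 0) → K ≤ pohozaev d p lam u v t := by
    intro t ht hv
    have h1 := pohozaev_sub_ge (κ := -(lam * X ^ 2)) hd hp H hz hτ0.le ht.1 ht.2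
      (fun q hq => hu q ⟨hτ0.le.trans hq.1.le, hq.2.le.trans ht.2⟩)
      (fun q hq => (hv q ⟨hτ0.trans hq.1, hq.2⟩).le)
      (fun q hq => by
        have h2 := hC (u q) (hu q ⟨hτ0.le.trans hq.1.le, hq.2.le.trans ht.2⟩)
        rw [← hδ, ← mul_neg]
        exact mul_le_mul_of_nonneg_left h2 hlam.le)
    have h3 : sin t ^ (d + 1) ≤ 1 := pow_le_one₀
      (sin_nonneg_of_mem_hemisphere ⟨hτ0.le.trans ht.1, ht.2⟩) (sin_le_one t)
    have h4 : 0 ≤ lam * X ^ 2 * (sin τ ^ (d + 1) / (d + 1)) := by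
      have := sin_nonneg_of_mem_hemisphere hτI
      positivity
    have h5 : lam * X ^ 2 * (sin t ^ (d + 1) / (d + 1)) ≤ lam * X ^ 2 / (d + 1) := by
      rw [mul_div_assoc']
      exact div_le_div_of_nonneg_right (mul_le_of_le_one_right (by positivity) h3) hd1.le
    linarith
  have hneg : ∀ t ∈ Ioc 0 (π / 2), v t < 0 := by
    intro t ht
    by_contra! hvt
    have hτt : τ < t := by
      by_contra! h
      exact absurd (hvτ t ⟨ht.1, h⟩) (not_lt.2 hvt)
    have hvc : ContinuousOn v (Icc τ t) := H.v_cont.mono (Icc_subset_Icc hτ0.le ht.2)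
    have hvττ := hvτ τ ⟨hτ0, le_rfl⟩
    obtain ⟨t₁, ht₁, hmin⟩ : ∃ t₁, IsLeast (Icc τ t ∩ v ⁻¹' {0}) t₁ := by
      refine IsCompact.exists_isLeast ?_ ?_
      · exact isCompact_Icc.of_isClosed_subset
          (hvc.preimage_isClosed_of_isClosed isClosed_Icc isClosed_singleton) inter_subset_left
      · obtain ⟨q, hq, h⟩ := intermediate_value_Icc hτt.le hvc
          (show (0 : ℝ) ∈ Icc _ _ from ⟨hvττ.le, hvt⟩)
        exact ⟨q, hq, h⟩
    have hneg : ∀ q ∈ Ioo 0 t₁, v q < 0 := by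
      intro q hq
      rcases le_or_gt q τ with h | h
      · exact hvτ q ⟨hq.1, h⟩
      · have hsub2 : Icc τ q ⊆ Icc τ t := Icc_subset_Icc_right (hq.2.le.trans ht₁.1.2)
        refine lt_of_forall_ne h.le (hvc.mono hsub2) hvττ fun x hx h0 => ?_
        have := hmin ⟨hsub2 hx, h0⟩
        linarith [hx.2, hq.2]
    have ht₁I : t₁ ∈ Icc τ (π / 2) := ⟨ht₁.1.1, ht₁.1.2.trans ht.2⟩
    exact flux_ne_zero_of_pohozaev_pos hp hlam H hu ⟨hτ0.trans_le ht₁I.1, ht₁I.2⟩ hneg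
      (hK0.trans_le (hP t₁ ht₁I hneg)) ht₁.2
  have hanti : AntitoneOn u (Icc 0 (π / 2)) :=
    antitoneOn_Icc_of_hasDerivAt H.u_cont H.u_deriv fun q hq =>
      div_nonpos_of_nonpos_of_nonneg (hneg q (Ioo_subset_Ioc_self hq)).le
        (pow_nonneg (sin_nonneg_of_mem_hemisphere (Ioo_subset_Icc_self hq)) d)
  have hMu := hM u v H hu hanti
  have hsub4 : Icc (π / 4) (π / 2) ⊆ Icc 0 (π / 2) := Icc_subset_Icc_left (by positivity)
  have hfin := antitoneOn_Icc_of_hasDerivAt (f := fun t => u t + 4 * M / π * t)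
    ((H.u_cont.mono hsub4).add (Continuous.continuousOn (by fun_prop)))
    (fun t ht => (H.u_deriv t ⟨by linarith [ht.1], ht.2⟩).add
      ((hasDerivAt_id t).const_mul (4 * M / π)))
    (fun t ht => by
      have htI : t ∈ Ioo 0 (π / 2) := ⟨by linarith [ht.1], ht.2⟩
      have hs := sin_pos_of_mem_hemisphere (Ioo_subset_Ioc_self htI)
      have hc := cos_nonneg_of_mem_hemisphere (Ioo_subset_Icc_self htI)
      have hut := hu t (Ioo_subset_Icc_self htI)
      have hvt := hneg t (Ioo_subset_Ioc_self htI)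
      have h1 := hP t ⟨by linarith [ht.1], ht.2.le⟩ fun q hq => hneg q ⟨hq.1, hq.2.le.trans ht.2.le⟩
      have hz0 : v t / sin t ^ d ≤ 0 := div_nonpos_of_nonpos_of_nonneg hvt.le (by positivity)
      have hutM : u t ≤ M :=
        (hanti (hsub4 (left_mem_Icc.2 (by linarith))) (Ioo_subset_Icc_self htI) ht.1.le).trans hMu
      have h2 : yamabePotential p lam (u t) ≤ lam * (M ^ p / p) := by
        have : u t ^ p ≤ M ^ p := rpow_le_rpow hut.le hutM (by linarith)
        rw [yamabePotential]
        have : u t ^ p / p ≤ M ^ p / p := by gcongr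
        gcongr
        nlinarith [sq_nonneg (u t)]
      have hd1 : (1 : ℝ) ≤ d := by exact_mod_cast Nat.one_le_iff_ne_zero.2 hd
      have h3 : 0 ≤ ((d : ℝ) - 1) / 2 * (cos t * (-v t) * u t) :=
        mul_nonneg (by linarith) (mul_nonneg (mul_nonneg hc (by linarith)) hut.le)
      have h4 : sin t ^ (d + 1) * ((v t / sin t ^ d) ^ 2 / 2 + yamabePotential p lam (u t)) ≤
          (v t / sin t ^ d) ^ 2 / 2 + lam * (M ^ p / p) := by
        have h5 : sin t ^ (d + 1) ≤ 1 := pow_le_one₀ hs.le (sin_le_one t)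
        have h6 : 0 ≤ (v t / sin t ^ d) ^ 2 / 2 + lam * (M ^ p / p) := by positivity
        calc _ ≤ sin t ^ (d + 1) * ((v t / sin t ^ d) ^ 2 / 2 + lam * (M ^ p / p)) := by gcongr
          _ ≤ _ := mul_le_of_le_one_left h6 h5
      rw [pohozaev] at h1
      have h7 : (4 * M / π) ^ 2 ≤ (-(v t / sin t ^ d)) ^ 2 := by
        rw [neg_sq]
        linarith
      have h8 := le_of_sq_le_sq h7 (by linarith)
      linarith)
    (left_mem_Icc.2 (by linarith)) (right_mem_Icc.2 (by linarith)) (show π / 4 ≤ π / 2 by linarith)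
  have h1 : 4 * M / π * (π / 2) = 2 * M := by field_simp; ring
  have h2 : 4 * M / π * (π / 4) = M := by field_simp
  have h3 := hu (π / 2) (right_mem_Icc.2 (by positivity))
  simp only [h1, h2] at hfin
  linarith

/-! ### Counting and matching in the plane of equatorial data -/

section Matching

variable {n : ℕ} {b₁ C : ℝ} {x y Θ r : ℝ → ℝ}

theorem exists_finset_equatorial {a₀ : ℝ} (ha₀ : a₀ ∈ Ioo 0 1) (hb : 1 < b₁)
    (hΘ : ContinuousOn Θ (Icc 0 b₁)) (hΘa : Θ a₀ < π) (hΘ1 : n * π < Θ 1) (hΘb : Θ b₁ < π) :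
    ∃ T : Finset ℝ, T.card = 2 * n + 1 ∧
      ∀ α ∈ T, α ∈ Ioo 0 b₁ ∧ (α = 1 ∨ sin (Θ α) = 0) := by
  have hpi := pi_pos
  have hlow : ∀ i : ℕ, π ≤ (i + 1 : ℝ) * π := fun i => by
    have : (0 : ℝ) ≤ i * π := by positivity
    linarith
  have hhigh : ∀ i ∈ Finset.range n, (i + 1 : ℝ) * π ≤ n * π := fun i hi => by
    have : (i + 1 : ℝ) ≤ n := by exact_mod_cast Finset.mem_range.1 hi
    gcongr
  have hL : ∀ i : ℕ, ∃ α, i ∈ Finset.range n → α ∈ Ioo a₀ 1 ∧ Θ α = (i + 1) * π := by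
    intro i
    by_cases hi : i ∈ Finset.range n
    · obtain ⟨α, h1, h2⟩ := intermediate_value_Ioo ha₀.2.le
        (hΘ.mono (Icc_subset_Icc ha₀.1.le hb.le))
        (show (i + 1 : ℝ) * π ∈ Ioo _ _ from
          ⟨hΘa.trans_le (hlow i), (hhigh i hi).trans_lt hΘ1⟩)
      exact ⟨α, fun _ => ⟨h1, h2⟩⟩
    · exact ⟨0, fun h => absurd h hi⟩
  have hR : ∀ i : ℕ, ∃ α, i ∈ Finset.range n → α ∈ Ioo 1 b₁ ∧ Θ α = (i + 1) * π := by
    intro i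
    by_cases hi : i ∈ Finset.range n
    · obtain ⟨α, h1, h2⟩ := intermediate_value_Ioo' hb.le
        (hΘ.mono (Icc_subset_Icc zero_le_one le_rfl))
        (show (i + 1 : ℝ) * π ∈ Ioo _ _ from
          ⟨hΘb.trans_le (hlow i), (hhigh i hi).trans_lt hΘ1⟩)
      exact ⟨α, fun _ => ⟨h1, h2⟩⟩
    · exact ⟨0, fun h => absurd h hi⟩
  choose l hl using hL
  choose s hs using hR
  have hinj : ∀ f : ℕ → ℝ, (∀ i ∈ Finset.range n, Θ (f i) = (i + 1) * π) →
      Set.InjOn f (Finset.range n) := by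
    intro f hf i hi j hj hij
    have h1 := hf i hi
    rw [hij, hf j hj] at h1
    have h2 := mul_right_cancel₀ hpi.ne' h1
    exact_mod_cast (add_right_cancel h2).symm
  have hsin : ∀ i : ℕ, sin ((i + 1) * π) = 0 := fun i => by exact_mod_cast sin_nat_mul_pi (i + 1)
  have hdisj : Disjoint ((Finset.range n).image l) ((Finset.range n).image s) := by
    rw [Finset.disjoint_left]
    intro α h1 h2
    obtain ⟨i, hi, rfl⟩ := Finset.mem_image.1 h1
    obtain ⟨j, hj, h⟩ := Finset.mem_image.1 h2
    linarith [(hl i hi).1.2, (hs j hj).1.1]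
  have hnot : (1 : ℝ) ∉ (Finset.range n).image l ∪ (Finset.range n).image s := by
    intro h
    rcases Finset.mem_union.1 h with h | h
    · obtain ⟨i, hi, h⟩ := Finset.mem_image.1 h
      linarith [(hl i hi).1.2]
    · obtain ⟨i, hi, h⟩ := Finset.mem_image.1 h
      linarith [(hs i hi).1.1]
  refine ⟨insert 1 ((Finset.range n).image l ∪ (Finset.range n).image s), ?_, ?_⟩
  · rw [Finset.card_insert_of_notMem hnot, Finset.card_union_of_disjoint hdisj,
      Finset.card_image_of_injOn (hinj l fun i hi => (hl i hi).2),
      Finset.card_image_of_injOn (hinj s fun i hi => (hs i hi).2), Finset.card_range]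
    ring
  · intro α hα
    rcases Finset.mem_insert.1 hα with rfl | h
    · exact ⟨⟨one_pos, hb⟩, Or.inl rfl⟩
    · rcases Finset.mem_union.1 h with h | h
      · obtain ⟨i, hi, rfl⟩ := Finset.mem_image.1 h
        have := hl i hi
        exact ⟨⟨ha₀.1.trans this.1.1, this.1.2.trans hb⟩, Or.inr (by rw [this.2, hsin])⟩
      · obtain ⟨i, hi, rfl⟩ := Finset.mem_image.1 h
        have := hs i hi
        exact ⟨⟨one_pos.trans this.1.1, this.1.2⟩, Or.inr (by rw [this.2, hsin])⟩

/-- The equatorial data `(x, y)` of the solutions below and above the constant solution meet, up to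
reflection, away from the horizontal axis. -/
theorem exists_matching (hb : 1 < b₁) (hΘ : ContinuousOn Θ (Icc 0 b₁))
    (hx : ContinuousOn x (Icc 0 b₁)) (hy : ContinuousOn y (Icc 0 b₁))
    (hr : ∀ α ∈ Icc 0 b₁, 0 < r α)
    (hxr : ∀ α ∈ Icc 0 b₁, x α = 1 + (α - 1) * (r α * cos (Θ α)))
    (hyr : ∀ α ∈ Icc 0 b₁, y α = (α - 1) * -(r α * sin (Θ α)))
    (hΘpos : ∀ α ∈ Ioc 0 b₁, 0 < Θ α) (hΘ1 : π < Θ 1) (hΘb : Θ b₁ < π)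
    (hxpos : ∀ α ∈ Ioo 0 b₁, 0 < x α) (hxb : x b₁ = 0) (hC : 0 < C)
    (hxC : ∀ α ∈ Ioo 0 1, x α ≤ C * α) (hyC : ∀ α ∈ Ioo 0 1, y α ≤ C * α)
    (hΘs : ∀ α ∈ Ioo 0 1, C * α < 1 → Θ α < π) :
    ∃ α ∈ Ioo 0 b₁, ∃ β ∈ Ioo 0 b₁, x α = x β ∧ y α = -y β ∧ y α ≠ 0 := by
  have hpi := pi_pos
  have hsub1 : Icc 1 b₁ ⊆ Icc 0 b₁ := Icc_subset_Icc_left zero_le_one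
  obtain ⟨b₀, hb₀, hgr⟩ : ∃ b₀, IsGreatest (Icc 1 b₁ ∩ Θ ⁻¹' {π}) b₀ := by
    refine IsCompact.exists_isGreatest ?_ ?_
    · exact isCompact_Icc.of_isClosed_subset
        ((hΘ.mono hsub1).preimage_isClosed_of_isClosed isClosed_Icc isClosed_singleton)
        inter_subset_left
    · obtain ⟨α, h1, h2⟩ := intermediate_value_Icc' hb.le (hΘ.mono hsub1)
        (show π ∈ Icc _ _ from ⟨hΘb.le, hΘ1.le⟩)
      exact ⟨α, h1, h2⟩
  have hΘb₀ : Θ b₀ = π := hb₀.2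
  have hb₀1 : 1 < b₀ := by
    refine lt_of_le_of_ne hb₀.1.1 fun h => ?_
    rw [← h] at hΘb₀
    linarith
  have hb₀b : b₀ < b₁ := by
    refine lt_of_le_of_ne hb₀.1.2 fun h => ?_
    rw [h] at hΘb₀
    linarith
  have hsubb : Icc b₀ b₁ ⊆ Icc 0 b₁ := Icc_subset_Icc_left (by linarith)
  have hΘR : ∀ s ∈ Ioc b₀ b₁, Θ s < π := by
    intro s hs
    by_contra! hle
    have hsub2 : Icc s b₁ ⊆ Icc b₀ b₁ := Icc_subset_Icc_left hs.1.le
    obtain ⟨α, h1, h2⟩ := intermediate_value_Icc' hs.2 (hΘ.mono (hsub2.trans hsubb))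
      (show π ∈ Icc _ _ from ⟨hΘb.le, hle⟩)
    have := hgr ⟨⟨by linarith [h1.1, hs.1], h1.2⟩, h2⟩
    linarith [h1.1, hs.1]
  have hYpos : ∀ s ∈ Ioc b₀ b₁, 0 < -y s := by
    intro s hs
    have hsI := hsubb (Ioc_subset_Icc_self hs)
    rw [hyr s hsI]
    have h1 := hr s hsI
    have h2 := sin_pos_of_pos_of_lt_pi (hΘpos s ⟨by linarith [hs.1], hs.2⟩) (hΘR s hs)
    have h3 : 0 < s - 1 := by linarith [hs.1]
    have : 0 < (s - 1) * (r s * sin (Θ s)) := by positivity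
    linarith
  have hYb₀ : -y b₀ = 0 := by
    rw [hyr b₀ (hsub1 hb₀.1), hΘb₀, sin_pi]
    ring
  have hsum : ∀ s ∈ Icc b₀ b₁, 0 < x s + -y s := by
    intro s hs
    rcases eq_or_lt_of_le hs.1 with h | h
    · have h1 := hxpos s ⟨by linarith, by linarith⟩
      rw [← h] at h1 ⊢
      linarith
    · have h1 := hYpos s ⟨h, hs.2⟩
      rcases eq_or_lt_of_le hs.2 with h' | h'
      · have hx0 : x s = 0 := by rw [h', hxb]
        linarith
      · have h2 := hxpos s ⟨by linarith, h'⟩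
        linarith
  obtain ⟨s₀, hs₀, hs₀min⟩ := isCompact_Icc.exists_isMinOn (nonempty_Icc.2 hb₀b.le)
    ((hx.mono hsubb).add (hy.mono hsubb).neg)
  set ρ : ℝ := x s₀ + -y s₀ with hρ
  have hρ0 : 0 < ρ := hsum s₀ hs₀
  obtain ⟨a₀, ha₀, ha₀'⟩ := exists_between
    (show (0 : ℝ) < min (1 / 2) (min (1 / (2 * C)) (ρ / (4 * C))) by positivity)
  have ha₀1 : a₀ < 1 := by linarith [ha₀'.trans_le (min_le_left _ _)]
  have hCa : C * a₀ < 1 := by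
    have h1 := (ha₀'.trans_le (min_le_right _ _)).trans_le (min_le_left _ _)
    rw [lt_div_iff₀ (by positivity)] at h1
    nlinarith
  have hCρ : 2 * (C * a₀) < ρ := by
    have h1 := (ha₀'.trans_le (min_le_right _ _)).trans_le (min_le_right _ _)
    rw [lt_div_iff₀ (by positivity)] at h1
    nlinarith
  have hΘa := hΘs a₀ ⟨ha₀, ha₀1⟩ hCa
  have hsuba : Icc a₀ 1 ⊆ Icc 0 b₁ := Icc_subset_Icc ha₀.le hb.le
  obtain ⟨a₁, ha₁, hls⟩ : ∃ a₁, IsLeast (Icc a₀ 1 ∩ Θ ⁻¹' {π}) a₁ := by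
    refine IsCompact.exists_isLeast ?_ ?_
    · exact isCompact_Icc.of_isClosed_subset
        ((hΘ.mono hsuba).preimage_isClosed_of_isClosed isClosed_Icc isClosed_singleton)
        inter_subset_left
    · obtain ⟨α, h1, h2⟩ := intermediate_value_Icc ha₀1.le (hΘ.mono hsuba)
        (show π ∈ Icc _ _ from ⟨hΘa.le, hΘ1.le⟩)
      exact ⟨α, h1, h2⟩
  have hΘa₁ : Θ a₁ = π := ha₁.2
  have ha₁1 : a₁ < 1 := by
    refine lt_of_le_of_ne ha₁.1.2 fun h => ?_
    rw [h] at hΘa₁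
    linarith
  have ha₀₁ : a₀ < a₁ := by
    refine lt_of_le_of_ne ha₁.1.1 fun h => ?_
    rw [← h] at hΘa₁
    linarith
  have hsub₁ : Icc a₀ a₁ ⊆ Icc 0 b₁ := Icc_subset_Icc ha₀.le (by linarith)
  have hya₁ : y a₁ = 0 := by
    rw [hyr a₁ (hsuba ha₁.1), hΘa₁, sin_pi]
    ring
  have hypos : ∀ s ∈ Ico a₀ a₁, 0 < y s := by
    intro s hs
    have hsI := hsub₁ (Ico_subset_Icc_self hs)
    have hsub2 : Icc a₀ s ⊆ Icc a₀ 1 := Icc_subset_Icc_right (hs.2.le.trans ha₁1.le)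
    have h0 := lt_of_forall_ne hs.1 (hΘ.mono (hsub2.trans hsuba)) hΘa fun q hq h => by
      have := hls ⟨hsub2 hq, h⟩
      linarith [hq.2, hs.2]
    rw [hyr s hsI]
    have h1 := hr s hsI
    have h2 := sin_pos_of_pos_of_lt_pi (hΘpos s ⟨by linarith [hs.1], hsI.2⟩) h0
    have h3 : 0 < 1 - s := by linarith [hs.2]
    have : 0 < (1 - s) * (r s * sin (Θ s)) := by positivity
    linarith
  have hXx : x b₀ < x a₁ := by
    have h1 : 0 < (b₀ - 1) * r b₀ := mul_pos (by linarith) (hr b₀ (hsub1 hb₀.1))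
    have h2 : 0 < (1 - a₁) * r a₁ := mul_pos (by linarith) (hr a₁ (hsuba ha₁.1))
    rw [hxr b₀ (hsub1 hb₀.1), hxr a₁ (hsuba ha₁.1), hΘb₀, hΘa₁, cos_pi]
    linarith
  obtain ⟨α, hα, β, hβ, h1, h2⟩ := exists_crossing (X := x) (Y := fun s => -y s) ha₀₁ hb₀b
    (hx.mono hsub₁) (hy.mono hsub₁) (hx.mono hsubb) (hy.mono hsubb).neg
    (fun s hs => hxpos s ⟨by linarith [hs.1], by linarith [hs.2]⟩) hypos hya₁ hYb₀ hYpos hxb hXx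
    (fun s hs => by
      have h1 : ρ ≤ x s + -y s := hs₀min hs
      linarith [hxC a₀ ⟨ha₀, ha₀1⟩, hyC a₀ ⟨ha₀, ha₀1⟩])
  have hxα := hxpos α ⟨by linarith [hα.1], by linarith [hα.2]⟩
  refine ⟨α, ⟨by linarith [hα.1], by linarith [hα.2]⟩, β, ⟨by linarith [hβ.1], ?_⟩, h1, h2, ?_⟩
  · refine lt_of_le_of_ne hβ.2 fun h => ?_
    rw [h1, h, hxb] at hxα
    exact lt_irrefl _ hxα
  · intro h0
    have hαa : α = a₁ := by
      by_contra hne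
      exact (hypos α ⟨hα.1, lt_of_le_of_ne hα.2 hne⟩).ne' h0
    have hβb : b₀ = β := by
      by_contra hne
      have := hYpos β ⟨lt_of_le_of_ne hβ.1 hne, hβ.2⟩
      linarith
    rw [hαa, ← hβb] at h1
    linarith

end Matching

/-! ### Continuous dependence on the initial value -/

theorem continuousOn_uncurry_of_uniform {W : ℝ → ℝ → ℝ} {I : Set ℝ}
    (hc : ∀ β, ContinuousOn (W β) I)
    (hu : ∀ β, ∀ ε > 0, ∀ᶠ α in nhds β, ∀ t ∈ I, |W α t - W β t| ≤ ε) (K : Set ℝ) :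
    ContinuousOn (fun x : ℝ × ℝ => W x.2 x.1) (I ×ˢ K) := by
  rintro ⟨t₀, β⟩ ⟨ht₀, -⟩
  rw [ContinuousWithinAt, Metric.tendsto_nhds]
  intro ε hε
  have h1 : ∀ᶠ x : ℝ × ℝ in nhdsWithin (t₀, β) (I ×ˢ K), ∀ t ∈ I, |W x.2 t - W β t| ≤ ε / 2 :=
    ((continuous_snd.tendsto (t₀, β)).mono_left nhdsWithin_le_nhds).eventually
      (hu β (ε / 2) (by positivity))
  have h2 : ∀ᶠ x : ℝ × ℝ in nhdsWithin (t₀, β) (I ×ˢ K), |W β x.1 - W β t₀| < ε / 2 := by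
    have h3 : ContinuousWithinAt (fun x : ℝ × ℝ => W β x.1) (I ×ˢ K) (t₀, β) :=
      ContinuousWithinAt.comp (t := I) (hc β t₀ ht₀) continuous_fst.continuousWithinAt
        fun x hx => hx.1
    exact (Metric.tendsto_nhds.1 h3) (ε / 2) (by positivity)
  filter_upwards [h1, h2, self_mem_nhdsWithin] with x h1 h2 hx
  have h3 := h1 x.1 hx.1
  rw [Real.dist_eq]
  have := abs_add_le (W x.2 x.1 - W β x.1) (W β x.1 - W β t₀)
  rw [sub_add_sub_cancel] at this
  linarith

/-- The difference quotients `W α = (U α - 1) / (α - 1)` of the solutions `U α` with initial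
value `α`, extended to `α = 1` by the solution of the linearised equation. -/
theorem exists_quotient_family {d : ℕ} (hd : d ≠ 0) {f g : ℝ → ℝ} {L : ℝ} (hL : 0 ≤ L)
    (hg : Continuous g) (hgL : ∀ x, |g x| ≤ L) (hfg : ∀ x, f x = g x * (x - 1))
    (hf : ∀ x y, |f x - f y| ≤ L * |x - y|) :
    ∃ W Y : ℝ → ℝ → ℝ,
      (∀ α, IsRadialSol d (fun t => g (1 + (α - 1) * W α t) * W α t) (W α) (Y α)) ∧
      (∀ α, W α 0 = 1) ∧
      (∀ K, ContinuousOn (fun x : ℝ × ℝ => W x.2 x.1) (Icc 0 (π / 2) ×ˢ K)) ∧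
      ∀ K, ContinuousOn (fun x : ℝ × ℝ => Y x.2 x.1) (Icc 0 (π / 2) ×ˢ K) := by
  have hLip : ∀ α x y, |g (1 + (α - 1) * x) * x - g (1 + (α - 1) * y) * y| ≤ L * |x - y| := by
    intro α x y
    by_cases hα : α - 1 = 0
    · simp only [hα, zero_mul, add_zero, ← mul_sub, abs_mul]
      exact mul_le_mul_of_nonneg_right (hgL 1) (abs_nonneg _)
    · have h1 := hf (1 + (α - 1) * x) (1 + (α - 1) * y)
      rw [hfg, hfg] at h1
      have h2 : g (1 + (α - 1) * x) * (1 + (α - 1) * x - 1) -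
          g (1 + (α - 1) * y) * (1 + (α - 1) * y - 1) =
          (α - 1) * (g (1 + (α - 1) * x) * x - g (1 + (α - 1) * y) * y) := by ring
      have h3 : 1 + (α - 1) * x - (1 + (α - 1) * y) = (α - 1) * (x - y) := by ring
      rw [h2, h3, abs_mul, abs_mul, mul_left_comm] at h1
      exact le_of_mul_le_mul_left h1 (abs_pos.2 hα)
  choose W Y H h0 using fun α => IsRadialSol.exists_of_lipschitz hd hL (hLip α) 1
  obtain ⟨C, hC, hstab⟩ := IsRadialSol.stability d hL
  have hunif : ∀ β, ∀ ε > 0, ∀ᶠ α in nhds β, ∀ t ∈ Icc 0 (π / 2),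
      |W α t - W β t| ≤ ε ∧ |Y α t - Y β t| ≤ ε := by
    intro β ε hε
    obtain ⟨R, hR⟩ := isCompact_Icc.exists_bound_of_continuousOn (H β).u_cont
    have hev : ∀ᶠ α in nhds β, ∀ w ∈ Icc (-R) R,
        |g (1 + (α - 1) * w) * w - g (1 + (β - 1) * w) * w| < ε / C := by
      refine isCompact_Icc.eventually_forall_of_forall_eventually fun w _ => ?_
      have hcont : Continuous fun z : ℝ × ℝ =>
          |g (1 + (z.1 - 1) * z.2) * z.2 - g (1 + (β - 1) * z.2) * z.2| := by fun_prop
      refine (hcont.tendsto (β, w)).eventually (gt_mem_nhds ?_)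
      simp only [sub_self, abs_zero]
      positivity
    filter_upwards [hev] with α hα t ht
    have := hstab _ _ _ _ _ _ (H α) (H β) (ε / C) (by positivity) (fun q hq => by
      have h1 := hLip α (W α q) (W β q)
      have h2 := hα (W β q) (abs_le.1 (hR q hq))
      have h3 := abs_sub_le (g (1 + (α - 1) * W α q) * W α q)
        (g (1 + (α - 1) * W β q) * W β q) (g (1 + (β - 1) * W β q) * W β q)
      linarith) t ht
    rwa [h0, h0, sub_self, abs_zero, zero_add, mul_div_cancel₀ _ hC.ne'] at this
  refine ⟨W, Y, H, h0, continuousOn_uncurry_of_uniform (fun β => (H β).u_cont) ?_,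
    continuousOn_uncurry_of_uniform (fun β => (H β).v_cont) ?_⟩
  · intro β ε hε
    filter_upwards [hunif β ε hε] with α hα t ht using (hα t ht).1
  · intro β ε hε
    filter_upwards [hunif β ε hε] with α hα t ht using (hα t ht).2

/-! ### The truncated nonlinearity -/

section Truncation

variable {p lam : ℝ}

theorem hasDerivAt_yamabeForce (hp : 2 < p) (x : ℝ) :
    HasDerivAt (yamabeForce p lam) (lam * ((p - 1) * x ^ (p - 2) - 1)) x := by
  have h1 := Real.hasDerivAt_rpow_const (x := x) (p := p - 1) (Or.inr (by linarith))
  refine ((h1.sub (hasDerivAt_id x)).const_mul lam).congr_deriv ?_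
  rw [show p - 1 - 1 = p - 2 by ring]

theorem yamabeForce_one : yamabeForce p lam 1 = 0 := by simp [yamabeForce]

theorem yamabeForce_zero (hp : 2 < p) : yamabeForce p lam 0 = 0 := by
  rw [yamabeForce, zero_rpow (by linarith), sub_zero, mul_zero]

theorem abs_yamabeForce_sub_le (hp : 2 < p) (hlam : 0 < lam) {B x y : ℝ} (hx : x ∈ Icc 0 B)
    (hy : y ∈ Icc 0 B) :
    |yamabeForce p lam x - yamabeForce p lam y| ≤ lam * ((p - 1) * B ^ (p - 2) + 1) * |x - y| := by
  refine (convex_Icc 0 B).norm_image_sub_le_of_norm_hasDerivWithin_le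
    (f' := fun x => lam * ((p - 1) * x ^ (p - 2) - 1))
    (fun z _ => (hasDerivAt_yamabeForce hp z).hasDerivWithinAt) (fun z hz => ?_) hy hx
  have h1 := rpow_le_rpow hz.1 hz.2 (show 0 ≤ p - 2 by linarith)
  have h2 := rpow_nonneg hz.1 (p - 2)
  have h3 : (p - 1) * z ^ (p - 2) ≤ (p - 1) * B ^ (p - 2) :=
    mul_le_mul_of_nonneg_left h1 (by linarith)
  have h4 : 0 ≤ (p - 1) * z ^ (p - 2) := mul_nonneg (by linarith) h2
  rw [norm_mul, norm_eq_abs, norm_eq_abs, abs_of_pos hlam]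
  refine mul_le_mul_of_nonneg_left ?_ hlam.le
  rw [abs_le]
  constructor <;> linarith

/-- The nonlinearity of the Yamabe equation agrees on `[0, B]` with a globally Lipschitz function
`f` that factors as `g x * (x - 1)`; the function `Φ` is a primitive of `f`. -/
theorem exists_truncation (hp : 2 < p) (hlam : 0 < lam) {B : ℝ} (hB : 1 < B) :
    ∃ f g Φ : ℝ → ℝ, ∃ L ≥ 0, Continuous g ∧ (∀ x, |g x| ≤ L) ∧ (∀ x, f x = g x * (x - 1)) ∧
      (∀ x y, |f x - f y| ≤ L * |x - y|) ∧ (∀ x, 0 < x → 0 < g x) ∧ g 1 = lam * (p - 2) ∧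
      (∀ x ∈ Icc 0 B, f x = yamabeForce p lam x) ∧ (∀ x, HasDerivAt Φ (f x) x) ∧
      (∀ x ∈ Icc 0 B, Φ x = yamabePotential p lam x) ∧
      ∀ x, B < x → yamabePotential p lam B < Φ x := by
  set f : ℝ → ℝ := fun x => yamabeForce p lam (max 0 (min x B)) with hf
  set L : ℝ := lam * ((p - 1) * B ^ (p - 2) + 1) with hLdef
  have hB0 : 0 < B := by linarith
  have hL0 : 0 ≤ L :=
    mul_nonneg hlam.le (add_nonneg (mul_nonneg (by linarith) (rpow_nonneg hB0.le _)) zero_le_one)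
  have hfc : Continuous f :=
    (continuous_yamabeForce hp).comp (continuous_const.max (continuous_id.min continuous_const))
  have hfeq : ∀ x ∈ Icc 0 B, f x = yamabeForce p lam x := by
    intro x hx
    simp only [hf, min_eq_left hx.2, max_eq_right hx.1]
  have hf1 : f 1 = 0 := by rw [hfeq 1 ⟨zero_le_one, hB.le⟩, yamabeForce_one]
  have hlip : ∀ x y, |f x - f y| ≤ L * |x - y| := by
    intro x y
    have hmem : ∀ x, max 0 (min x B) ∈ Icc 0 B := fun x =>
      ⟨le_max_left _ _, max_le hB0.le (min_le_right _ _)⟩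
    refine (abs_yamabeForce_sub_le hp hlam (hmem x) (hmem y)).trans ?_
    refine mul_le_mul_of_nonneg_left ?_ hL0
    calc |max 0 (min x B) - max 0 (min y B)| ≤ |min x B - min y B| := by
          simpa using abs_max_sub_max_le_max 0 (min x B) 0 (min y B)
      _ ≤ |x - y| := by simpa using abs_min_sub_min_le_max x B y B
  have hfd : HasDerivAt f (lam * (p - 2)) 1 := by
    have h := hasDerivAt_yamabeForce (lam := lam) hp 1
    rw [one_rpow, show lam * ((p - 1) * 1 - 1) = lam * (p - 2) by ring] at h
    refine h.congr_of_eventuallyEq ?_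
    filter_upwards [Ioo_mem_nhds zero_lt_one hB] with x hx using hfeq x (Ioo_subset_Icc_self hx)
  have hfg : ∀ x, f x = dslope f 1 x * (x - 1) := by
    intro x
    have := sub_smul_dslope f 1 x
    rw [hf1, sub_zero, smul_eq_mul] at this
    rw [← this, mul_comm]
  have hg1 : dslope f 1 1 = lam * (p - 2) := by rw [dslope_same, hfd.deriv]
  have hgp : ∀ x, 0 < x → 0 < dslope f 1 x := by
    intro x hx
    rcases lt_trichotomy x 1 with h | h | h
    · have h1 := yamabeForce_neg hp hlam hx h
      rw [← hfeq x ⟨hx.le, by linarith⟩, hfg] at h1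
      nlinarith
    · rw [h, hg1]
      exact mul_pos hlam (by linarith)
    · have h1 : 0 < f x :=
        yamabeForce_pos hp hlam (lt_max_of_lt_right (lt_min h hB))
      rw [hfg] at h1
      exact (pos_iff_pos_of_mul_pos h1).2 (by linarith)
  have hgL : ∀ x, |dslope f 1 x| ≤ L := by
    intro x
    rcases eq_or_ne x 1 with h | h
    · rw [h, hg1, abs_of_pos (mul_pos hlam (by linarith))]
      refine mul_le_mul_of_nonneg_left ?_ hlam.le
      have := one_le_rpow hB.le (show 0 ≤ p - 2 by linarith)
      nlinarith
    · have h1 := hlip x 1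
      rw [hf1, sub_zero, hfg, abs_mul] at h1
      exact le_of_mul_le_mul_right h1 (abs_pos.2 (sub_ne_zero.2 h))
  have hΦ : ∀ x, HasDerivAt (fun x => ∫ t in (0 : ℝ)..x, f t) (f x) x := fun x =>
    intervalIntegral.integral_hasDerivAt_right (hfc.intervalIntegrable _ _)
      (hfc.stronglyMeasurableAtFilter _ _) hfc.continuousAt
  have hΦeq : ∀ x ∈ Icc 0 B, (∫ t in (0 : ℝ)..x, f t) = yamabePotential p lam x := by
    intro x hx
    rw [intervalIntegral.integral_eq_sub_of_hasDerivAt (f := yamabePotential p lam)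
      (fun t ht => ?_) (hfc.intervalIntegrable _ _)]
    · rw [yamabePotential, yamabePotential, zero_rpow (by linarith)]
      simp
    · rw [uIcc_of_le hx.1] at ht
      rw [hfeq t ⟨ht.1, ht.2.trans hx.2⟩]
      exact hasDerivAt_yamabePotential hp t
  refine ⟨f, dslope f 1, _, L, hL0, ?_, hgL, hfg, hlip, hgp, hg1, hfeq, hΦ, hΦeq, ?_⟩
  · rw [continuous_iff_continuousAt]
    intro x
    rcases eq_or_ne x 1 with h | h
    · rw [h, continuousAt_dslope_same]
      exact hfd.differentiableAt
    · rw [continuousAt_dslope_of_ne h]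
      exact hfc.continuousAt
  · intro x hx
    rw [← hΦeq B ⟨hB0.le, le_rfl⟩]
    refine strictMonoOn_Icc_of_hasDerivAt (a := B) (b := x)
      (fun t _ => (hΦ t).continuousAt.continuousWithinAt) (fun t _ => hΦ t) (fun t ht => ?_)
      (left_mem_Icc.2 hx.le) (right_mem_Icc.2 hx.le) hx
    exact yamabeForce_pos hp hlam (lt_max_of_lt_right (lt_min (hB.trans ht.1) hB))

end Truncation

/-! ### Shooting from the pole -/

theorem IsRadialSol.antitoneOn_energy {d : ℕ} {f Φ u v : ℝ → ℝ} (hd : d ≠ 0) (hf : Continuous f)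
    (hΦ : ∀ x, HasDerivAt Φ (f x) x) (H : IsRadialSol d (fun t => f (u t)) u v) :
    AntitoneOn (fun t => (v t / sin t ^ d) ^ 2 / 2 + Φ (u t)) (Icc 0 (π / 2)) := by
  obtain ⟨C, hC⟩ := isCompact_Icc.exists_bound_of_continuousOn (hf.comp_continuousOn H.u_cont)
  have hΦc : Continuous Φ := continuous_iff_continuousAt.2 fun x => (hΦ x).continuousAt
  refine antitoneOn_Icc_of_hasDerivAt
    (f' := fun t => -(d * (cos t / sin t) * (v t / sin t ^ d) ^ 2)) ?_ (fun t ht => ?_)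
    (fun t ht => ?_)
  · exact (((H.continuousOn_deriv hd fun t ht => hC t (Ioo_subset_Icc_self ht)).pow 2).div_const
      2).add (hΦc.comp_continuousOn H.u_cont)
  · refine ((((H.hasDerivAt_deriv ht).pow 2).div_const 2).add
      ((hΦ (u t)).comp t (H.u_deriv t ht))).congr_deriv ?_
    push_cast
    ring
  · have h1 := sin_pos_of_mem_hemisphere (Ioo_subset_Ioc_self ht)
    have h2 := cos_nonneg_of_mem_hemisphere (Ioo_subset_Icc_self ht)
    have : 0 ≤ (d : ℝ) * (cos t / sin t) * (v t / sin t ^ d) ^ 2 := by positivity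
    linarith

theorem yamabePotential_le_of_le {p lam : ℝ} (hp : 2 < p) (hlam : 0 < lam) {x B : ℝ} (hx : 0 < x)
    (hxB : x ≤ B) (hB : 0 ≤ yamabePotential p lam B) :
    yamabePotential p lam x ≤ yamabePotential p lam B := by
  rcases le_total x 1 with h | h
  · exact (yamabePotential_neg hp hlam hx h).le.trans hB
  · refine monotoneOn_Icc_of_hasDerivAt (a := x) (b := B)
      (fun t _ => (hasDerivAt_yamabePotential hp t).continuousAt.continuousWithinAt)
      (fun t _ => hasDerivAt_yamabePotential hp t) (fun t ht => ?_)
      (left_mem_Icc.2 hxB) (right_mem_Icc.2 hxB) hxB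
    exact (yamabeForce_pos hp hlam (h.trans_lt ht.1)).le

theorem exists_first_nonpos {U : ℝ → ℝ → ℝ} {a b c e : ℝ} (hce : c ≤ e)
    (hU : ContinuousOn (fun x : ℝ × ℝ => U x.2 x.1) (Icc a b ×ˢ Icc c e))
    (hc : ∀ t ∈ Icc a b, 0 < U c t) (he : ∃ t ∈ Icc a b, U e t ≤ 0) :
    ∃ b₁ ∈ Ioc c e, (∀ α ∈ Ico c b₁, ∀ t ∈ Icc a b, 0 < U α t) ∧
      (∀ t ∈ Icc a b, 0 ≤ U b₁ t) ∧ ∃ t ∈ Icc a b, U b₁ t = 0 := by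
  set D : Set (ℝ × ℝ) := (Icc a b ×ˢ Icc c e) ∩ (fun x : ℝ × ℝ => U x.2 x.1) ⁻¹' Iic 0 with hD
  have hDc : IsCompact D := (isCompact_Icc.prod isCompact_Icc).of_isClosed_subset
    (hU.preimage_isClosed_of_isClosed (isClosed_Icc.prod isClosed_Icc) isClosed_Iic)
    inter_subset_left
  obtain ⟨t₁, ht₁, hle₁⟩ := he
  obtain ⟨b₁, ⟨⟨t₀, b₁'⟩, ⟨⟨ht₀, hb₁⟩, hle⟩, rfl⟩, hmin⟩ :=
    (hDc.image continuous_snd).exists_isLeast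
      ⟨e, (t₁, e), ⟨⟨ht₁, hce, le_rfl⟩, hle₁⟩, rfl⟩
  simp only [mem_preimage, mem_Iic] at ht₀ hb₁ hle hmin ⊢
  have hpos : ∀ α ∈ Ico c b₁', ∀ t ∈ Icc a b, 0 < U α t := by
    intro α hα t ht
    by_contra h
    exact hα.2.not_ge (hmin ⟨(t, α), ⟨⟨ht, hα.1, hα.2.le.trans hb₁.2⟩, not_lt.1 h⟩, rfl⟩)
  have hcb : c < b₁' := by
    refine lt_of_le_of_ne hb₁.1 fun h => ?_
    rw [← h] at hle
    exact (hc t₀ ht₀).not_ge hle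
  have hnn : ∀ t ∈ Icc a b, 0 ≤ U b₁' t := by
    intro t ht
    by_contra h
    have hcont : ContinuousOn (fun α => U α t) (Icc c b₁') :=
      hU.comp (f := fun α : ℝ => (t, α)) (by fun_prop)
        (fun α hα => ⟨ht, hα.1, hα.2.trans hb₁.2⟩)
    obtain ⟨α, hα, h0⟩ := intermediate_value_Ioo' hcb.le hcont
      (show (0 : ℝ) ∈ Ioo _ _ from ⟨not_le.1 h, hc t ht⟩)
    exact (hpos α ⟨hα.1.le, hα.2⟩ t ht).ne' h0
  exact ⟨b₁', ⟨hcb, hb₁.2⟩, hpos, hnn, t₀, ht₀, le_antisymm hle (hnn t₀ ht₀)⟩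

/-- A nonnegative solution with positive initial value can vanish only at the equator, and then
transversally. -/
theorem IsRadialSol.pos_of_nonneg {d : ℕ} {h u v : ℝ → ℝ} (H : IsRadialSol d h u v) {L : ℝ}
    (hL : 0 ≤ L) (hh : ∀ t ∈ Icc 0 (π / 2), |h t| ≤ L * |u t|) (h0 : 0 < u 0)
    (hu : ∀ t ∈ Icc 0 (π / 2), 0 ≤ u t) :
    (∀ t ∈ Ico 0 (π / 2), 0 < u t) ∧ (u (π / 2) = 0 → v (π / 2) ≠ 0) := by
  have hh' : ∀ t ∈ Icc 0 (π / 2), |h t| ≤ L * |u t - 0| := by simpa using hh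
  refine ⟨fun t ht => ?_, fun hu0 hv0 => ?_⟩
  · refine lt_of_le_of_ne (hu t (Ico_subset_Icc_self ht)) fun hut => ?_
    have ht0 : 0 < t := lt_of_le_of_ne ht.1 fun h => by rw [← h] at hut; exact h0.ne hut
    have hmin : IsLocalMin u t := by
      filter_upwards [Ioo_mem_nhds ht0 ht.2] with q hq
      rw [← hut]
      exact hu q (Ioo_subset_Icc_self hq)
    have hz := hmin.hasDerivAt_eq_zero (H.u_deriv t ⟨ht0, ht.2⟩)
    have hs := sin_pos_of_mem_hemisphere ⟨ht0, ht.2.le⟩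
    have hv : v t = 0 := by
      rcases div_eq_zero_iff.1 hz with h | h
      · exact h
      · exact absurd h (pow_pos hs d).ne'
    exact h0.ne' (H.eq_of_hits hL hh' ⟨ht0, ht.2.le⟩ hut.symm hv)
  · exact h0.ne' (H.eq_of_hits hL hh' ⟨by positivity, le_rfl⟩ hu0 hv0)

theorem isPruferAngle_one : IsPruferAngle (fun _ => 1) (fun _ => 0) (fun _ => 0) :=
  ⟨continuousOn_const, rfl, fun _ _ => ⟨1, one_pos, by simp, by simp⟩⟩

/-- The family of positive radial solutions on the hemisphere: many of them satisfy the Neumann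
condition at the equator, and two of them match with a nonzero flux. -/
theorem exists_shooting {d n : ℕ} (hd : d ≠ 0) (hn : 1 ≤ n) {p lam : ℝ} (hp : 2 < p)
    (hlam : 0 < lam) (hsub : ((d : ℝ) + 1) * (p - 2) < 2 * p)
    (hμ : 2 * n * (2 * n + d) < lam * (p - 2)) :
    ∃ (I : Set ℝ) (U V : ℝ → ℝ → ℝ),
      (∀ α ∈ I, 0 < α ∧ IsRadialSol d (fun t => yamabeForce p lam (U α t)) (U α) (V α) ∧
        U α 0 = α ∧ ∀ t ∈ Icc 0 (π / 2), 0 < U α t) ∧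
      (∃ T : Finset ℝ, T.card = 2 * n + 1 ∧ ∀ α ∈ T, α ∈ I ∧ V α (π / 2) = 0) ∧
      ∃ α ∈ I, ∃ β ∈ I, U α (π / 2) = U β (π / 2) ∧ V α (π / 2) = -V β (π / 2) ∧
        V α (π / 2) ≠ 0 := by
  have hpi := pi_pos
  have h0mem : (0 : ℝ) ∈ Icc 0 (π / 2) := left_mem_Icc.2 (by positivity)
  have hemem : π / 2 ∈ Icc 0 (π / 2) := right_mem_Icc.2 (by positivity)
  obtain ⟨B₀, hB₀, hlarge⟩ := exists_no_large_positive_sol hd hp hlam hsub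
  obtain ⟨X, hX1, hX⟩ := exists_le_rpow hp (p / 2)
  set B : ℝ := max B₀ (max 2 X) with hBdef
  have hBB₀ : B₀ ≤ B := le_max_left _ _
  have hB1 : 1 < B := by have : 2 ≤ B := (le_max_left _ _).trans (le_max_right _ _); linarith
  have hB0 : 0 < B := by linarith
  have hFB : 0 ≤ yamabePotential p lam B := by
    have h1 := hX B ((le_max_right _ _).trans (le_max_right _ _))
    rw [yamabePotential, rpow_eq_mul_sq hB0]
    refine mul_nonneg hlam.le (sub_nonneg.2 ?_)
    rw [div_le_div_iff₀ two_pos (by linarith)]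
    nlinarith [sq_nonneg B]
  obtain ⟨f, g, Φ, L, hL, hg, hgL, hfg, hlip, hgpos, hg1, hf, hΦ, hΦF, hΦB⟩ :=
    exists_truncation hp hlam hB1
  have hfc : Continuous f := by
    rw [show f = fun x => g x * (x - 1) from funext hfg]
    fun_prop
  have hf0 : f 0 = 0 := by rw [hf 0 ⟨le_rfl, hB0.le⟩, yamabeForce_zero hp]
  have hΦ0 : Φ 0 = 0 := by
    rw [hΦF 0 ⟨le_rfl, hB0.le⟩, yamabePotential, zero_rpow (by linarith)]
    simp
  have hfL : ∀ x, |f x| ≤ L * |x| := fun x => by simpa [hf0] using hlip x 0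
  obtain ⟨W, Y, HW, hW0, hWc, hYc⟩ := exists_quotient_family hd hL hg hgL hfg hlip
  set U : ℝ → ℝ → ℝ := fun α t => 1 + (α - 1) * W α t with hU
  set V : ℝ → ℝ → ℝ := fun α t => (α - 1) * Y α t with hV
  have HU : ∀ α, IsRadialSol d (fun t => f (U α t)) (U α) (V α) := by
    intro α
    have := (HW α).affine (α - 1) 1
    have e : (fun t => (α - 1) * W α t + 1) = U α := funext fun t => add_comm _ _
    rw [e] at this
    refine this.congr fun t _ => ?_
    rw [hfg]
    simp only [hU]
    ring
  have hUα : ∀ α, U α 0 = α := fun α => by simp [hU, hW0]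
  have hen := fun α => (HU α).antitoneOn_energy hd hfc hΦ
  have hen0 : ∀ α ∈ Ioc 0 B, ∀ t ∈ Icc 0 (π / 2), Φ (U α t) ≤ yamabePotential p lam α := by
    intro α hα t ht
    have h1 := hen α h0mem ht ht.1
    simp only [(HU α).v_zero, hUα, zero_div] at h1
    rw [hΦF α ⟨hα.1.le, hα.2⟩] at h1
    have := sq_nonneg (V α t / sin t ^ d)
    linarith
  have hUB : ∀ α ∈ Ioc 0 B, ∀ t ∈ Icc 0 (π / 2), U α t ≤ B := by
    intro α hα t ht
    by_contra h
    have h1 := hΦB _ (not_le.1 h)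
    have h2 := yamabePotential_le_of_le hp hlam hα.1 hα.2 hFB
    linarith [hen0 α hα t ht]
  have hUsmall : ∀ α ∈ Ioc 0 1, ∀ t ∈ Icc 0 (π / 2), 0 < U α t := by
    intro α hα t ht
    by_contra h
    obtain ⟨q, hq, hq0⟩ := intermediate_value_Icc' ht.1
      ((HU α).u_cont.mono (Icc_subset_Icc_right ht.2))
      (show (0 : ℝ) ∈ Icc _ _ from ⟨not_lt.1 h, by rw [hUα]; exact hα.1.le⟩)
    have h1 := hen0 α ⟨hα.1, hα.2.trans hB1.le⟩ q ⟨hq.1, hq.2.trans ht.2⟩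
    rw [hq0, hΦ0] at h1
    linarith [yamabePotential_neg hp hlam hα.1 hα.2]
  have htrue : ∀ α ∈ Ioc 0 B, (∀ t ∈ Icc 0 (π / 2), 0 < U α t) →
      IsRadialSol d (fun t => yamabeForce p lam (U α t)) (U α) (V α) := fun α hα hpos =>
    (HU α).congr fun t ht => by
      have ht' := Ioo_subset_Icc_self ht
      exact (hf _ ⟨(hpos t ht').le, hUB α hα t ht'⟩).symm
  have hUc : ∀ K : Set ℝ, ContinuousOn (fun x : ℝ × ℝ => U x.2 x.1) (Icc 0 (π / 2) ×ˢ K) :=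
    fun K => continuousOn_const.add
      ((continuous_snd.sub continuous_const).continuousOn.mul (hWc K))
  obtain ⟨b₁, hb₁, hUpos, hUnn, t₀, ht₀, hUt₀⟩ := exists_first_nonpos (U := U) hB1.le (hUc _)
    (hUsmall 1 ⟨one_pos, le_rfl⟩) (by
      by_contra! h
      have hBmem : B ∈ Ioc 0 B := ⟨hB0, le_rfl⟩
      have := hlarge _ _ (htrue B hBmem h) h (fun t ht => by rw [hUα]; exact hUB B hBmem t ht)
      rw [hUα] at this
      linarith)
  have hb₁0 : 0 < b₁ := by linarith [hb₁.1]
  have hUpos' : ∀ α ∈ Ioo 0 b₁, ∀ t ∈ Icc 0 (π / 2), 0 < U α t := by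
    intro α hα
    rcases le_total α 1 with h | h
    · exact hUsmall α ⟨hα.1, h⟩
    · exact hUpos α ⟨h, hα.2⟩
  obtain ⟨hpos₁, hV₁⟩ := (HU b₁).pos_of_nonneg hL (fun t _ => hfL _) (by rwa [hUα]) hUnn
  have hU₁ : U b₁ (π / 2) = 0 := by
    rcases eq_or_lt_of_le ht₀.2 with h | h
    · rwa [h] at hUt₀
    · exact absurd hUt₀ (hpos₁ t₀ ⟨ht₀.1, h⟩).ne'
  replace hV₁ := hV₁ hU₁
  have hUpos₂ : ∀ α ∈ Ioc 0 b₁, ∀ t ∈ Ico 0 (π / 2), 0 < U α t := by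
    intro α hα t ht
    rcases eq_or_lt_of_le hα.2 with h | h
    · rw [h]; exact hpos₁ t ht
    · exact hUpos' α ⟨hα.1, h⟩ t (Ico_subset_Icc_self ht)
  obtain ⟨θ, Aθ, hΘ⟩ := exists_pruferAngle_family (K := Icc 0 b₁) isCompact_Icc (hWc _) (hYc _) hL
    (fun α _ => HW α) (fun α _ t _ => by
      rw [abs_mul]
      exact mul_le_mul_of_nonneg_right (hgL _) (abs_nonneg _)) (fun α _ => hW0 α)
  have h1mem : (1 : ℝ) ∈ Icc 0 b₁ := ⟨zero_le_one, hb₁.1.le⟩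
  have hΘpos : ∀ α ∈ Ioc 0 b₁, 0 < θ α (π / 2) := by
    intro α hα
    refine IsPruferAngle.lt (c₁ := fun _ => 0) (by simpa using IsRadialSol.const d 1) (HW α)
      isPruferAngle_one (Aθ α ⟨hα.1.le, hα.2⟩) (fun t ht => ?_) (π / 2) ⟨by positivity, le_rfl⟩
    exact hgpos _ (hUpos₂ α hα t ⟨ht.1.le, ht.2⟩)
  have hΘ1 : n * π < θ 1 (π / 2) := by
    refine IsPruferAngle.nat_mul_pi_lt hμ ?_ (Aθ 1 h1mem)
    refine (HW 1).congr fun t _ => ?_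
    rw [sub_self, zero_mul, add_zero, hg1]
  have hπ : ∀ α ∈ Icc 0 b₁, ∀ t ∈ Icc 0 (π / 2), θ α t = π → ∃ r > 0, W α t = -r ∧ Y α t = 0 := by
    intro α hα t ht h
    obtain ⟨r, hr, hw, hy⟩ := (Aθ α hα).polar t ht
    rw [h] at hw hy
    exact ⟨r, hr, by simpa using hw, by simpa using hy⟩
  have hΘlt : ∀ α ∈ Icc 0 b₁, (∀ t ∈ Icc 0 (π / 2), θ α t ≠ π) → θ α (π / 2) < π :=
    fun α hα h => lt_of_forall_ne (by positivity) (Aθ α hα).cont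
      (by rw [(Aθ α hα).zero]; exact hpi) h
  have hΘb : θ b₁ (π / 2) < π := by
    have hmem : b₁ ∈ Icc 0 b₁ := ⟨hb₁0.le, le_rfl⟩
    refine hΘlt b₁ hmem fun t ht h => ?_
    obtain ⟨r, hr, hw, hy⟩ := hπ b₁ hmem t ht h
    have hVt : V b₁ t = 0 := by simp [hV, hy]
    rcases eq_or_lt_of_le ht.2 with h' | h'
    · rw [h'] at hVt
      exact hV₁ hVt
    · have h1 := hpos₁ t ⟨ht.1, h'⟩
      have h2 : U b₁ t < 1 := by
        simp only [hU, hw]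
        have := mul_pos (sub_pos.2 hb₁.1) hr
        linarith
      have h3 := hen b₁ ht hemem ht.2
      simp only [hVt, hU₁, hΦ0, zero_div] at h3
      rw [hΦF _ ⟨h1.le, by linarith⟩] at h3
      have h4 := yamabePotential_neg hp hlam h1 h2.le
      have := sq_nonneg (V b₁ (π / 2) / sin (π / 2) ^ d)
      linarith
  obtain ⟨C, hC, hstab⟩ := IsRadialSol.stability d hL
  have hUVC : ∀ α ∈ Ioo 0 1, ∀ t ∈ Icc 0 (π / 2), U α t ≤ C * α ∧ V α t ≤ C * α := by
    intro α hα t ht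
    have := hstab _ _ _ _ _ _ (HU α) (IsRadialSol.const d 0) 0 le_rfl
      (fun t _ => by simpa using hfL (U α t)) t ht
    simp only [sub_zero, add_zero, hUα, abs_of_pos hα.1] at this
    exact ⟨(le_abs_self _).trans this.1, (le_abs_self _).trans this.2⟩
  have hΘs : ∀ α ∈ Ioo 0 1, C * α < 1 → θ α (π / 2) < π := by
    intro α hα hCα
    have hmem : α ∈ Icc 0 b₁ := ⟨hα.1.le, hα.2.le.trans hb₁.1.le⟩
    refine hΘlt α hmem fun t ht h => ?_
    obtain ⟨r, hr, hw, -⟩ := hπ α hmem t ht h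
    have h1 := (hUVC α hα t ht).1
    simp only [hU, hw] at h1
    have := mul_pos (sub_pos.2 hα.2) hr
    linarith
  have ha₀ : 1 / (C + 2) ∈ Ioo (0 : ℝ) 1 :=
    ⟨by positivity, by rw [div_lt_one (by linarith)]; linarith⟩
  have hpolar : ∀ α ∈ Icc 0 b₁, ∃ r > 0, W α (π / 2) = r * cos (θ α (π / 2)) ∧
      Y α (π / 2) = -(r * sin (θ α (π / 2))) := fun α hα => (Aθ α hα).polar (π / 2) hemem
  choose! r hr hWr hYr using hpolar
  have hsec : ∀ F : ℝ → ℝ → ℝ, ContinuousOn (fun x : ℝ × ℝ => F x.2 x.1)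
      (Icc 0 (π / 2) ×ˢ Icc 0 b₁) → ContinuousOn (fun α => F α (π / 2)) (Icc 0 b₁) := fun F hF =>
    hF.comp (f := fun α : ℝ => (π / 2, α)) (by fun_prop) (fun α hα => ⟨hemem, hα⟩)
  refine ⟨Ioo 0 b₁, U, V, fun α hα => ⟨hα.1, htrue α ⟨hα.1, hα.2.le.trans hb₁.2⟩ (hUpos' α hα),
    hUα α, hUpos' α hα⟩, ?_, ?_⟩
  · obtain ⟨T, hT, hTα⟩ := exists_finset_equatorial ha₀ hb₁.1 hΘ
      (hΘs _ ha₀ (by rw [mul_one_div, div_lt_one (by linarith)]; linarith)) hΘ1 hΘb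
    refine ⟨T, hT, fun α hα => ⟨(hTα α hα).1, ?_⟩⟩
    simp only [hV]
    rcases (hTα α hα).2 with h | h
    · rw [h, sub_self, zero_mul]
    · rw [hYr α (Ioo_subset_Icc_self (hTα α hα).1), h, mul_zero, neg_zero, mul_zero]
  · have hn' : (1 : ℝ) ≤ n := by exact_mod_cast hn
    exact exists_matching (x := fun α => U α (π / 2)) (y := fun α => V α (π / 2)) hb₁.1 hΘ
      (hsec U (hUc _))
      ((continuous_id.sub continuous_const).continuousOn.mul (hsec Y (hYc _))) hr
      (fun α hα => by simp only [hU, hWr α hα]) (fun α hα => by simp only [hV, hYr α hα])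
      hΘpos (by nlinarith) hΘb (fun α hα => hUpos' α hα _ hemem) hU₁ hC
      (fun α hα => (hUVC α hα _ hemem).1) (fun α hα => (hUVC α hα _ hemem).2) hΘs

/-! ### Gluing two hemispheres -/

theorem hasDerivAt_of_eventually_hasDerivAt {f g : ℝ → ℝ} {x : ℝ}
    (h : ∀ᶠ y in nhdsWithin x {x}ᶜ, HasDerivAt f (g y) y) (hf : ContinuousAt f x)
    (hg : ContinuousAt g x) : HasDerivAt f (g x) x := by
  have hR : ∀ᶠ y in nhdsWithin x (Ioi x), HasDerivAt f (g y) y :=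
    h.filter_mono (nhdsWithin_mono _ fun y hy => ne_of_gt hy)
  have hL : ∀ᶠ y in nhdsWithin x (Iio x), HasDerivAt f (g y) y :=
    h.filter_mono (nhdsWithin_mono _ fun y hy => ne_of_lt hy)
  have A : HasDerivWithinAt f (g x) (Ici x) x := by
    refine hasDerivWithinAt_Ici_of_tendsto_deriv (s := {y | HasDerivAt f (g y) y})
      (fun y hy => hy.differentiableAt.differentiableWithinAt) hf.continuousWithinAt hR ?_
    exact (hg.tendsto.mono_left nhdsWithin_le_nhds).congr' (hR.mono fun y hy => hy.deriv.symm)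
  have B : HasDerivWithinAt f (g x) (Iic x) x := by
    refine hasDerivWithinAt_Iic_of_tendsto_deriv (s := {y | HasDerivAt f (g y) y})
      (fun y hy => hy.differentiableAt.differentiableWithinAt) hf.continuousWithinAt hL ?_
    exact (hg.tendsto.mono_left nhdsWithin_le_nhds).congr' (hL.mono fun y hy => hy.deriv.symm)
  simpa using B.union A

theorem IsRadialSol.exists_extension {d : ℕ} {f u v : ℝ → ℝ} (hd : d ≠ 0) (hf : Continuous f)
    (H : IsRadialSol d (fun t => f (u t)) u v) :
    ∃ U Z : ℝ → ℝ, Continuous U ∧ Continuous Z ∧ (∀ t < π / 2, HasDerivAt U (Z t) t) ∧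
      (∀ t ∈ Ioo 0 (π / 2), HasDerivAt Z (-f (U t) - d * (cos t / sin t) * Z t) t) ∧
      (∀ t ∈ Icc 0 (π / 2), U t = u t) ∧ Z 0 = 0 ∧ Z (π / 2) = v (π / 2) := by
  have hle : (0 : ℝ) ≤ π / 2 := by positivity
  obtain ⟨C, hC⟩ := isCompact_Icc.exists_bound_of_continuousOn (hf.comp_continuousOn H.u_cont)
  set z : ℝ → ℝ := fun t => v t / sin t ^ d with hz
  set c : ℝ → ℝ := fun t => max 0 (min t (π / 2)) with hc
  have hcc : Continuous c := by fun_prop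
  have hcm : ∀ t, c t ∈ Icc 0 (π / 2) := fun t =>
    ⟨le_max_left _ _, max_le hle (min_le_right _ _)⟩
  have hcid : ∀ t ∈ Icc 0 (π / 2), c t = t := fun t ht => by
    simp only [hc, min_eq_left ht.2, max_eq_right ht.1]
  have hUc : Continuous fun t => u (c t) := H.u_cont.comp_continuous hcc hcm
  have hZc : Continuous fun t => z (c t) :=
    (H.continuousOn_deriv hd fun t ht => hC t (Ioo_subset_Icc_self ht)).comp_continuous hcc hcm
  have hz0 : z 0 = 0 := by simp [hz, H.v_zero]
  have hin : ∀ t ∈ Ioo 0 (π / 2), c =ᶠ[nhds t] id := fun t ht => by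
    filter_upwards [Ioo_mem_nhds ht.1 ht.2] with q hq using hcid q (Ioo_subset_Icc_self hq)
  have hpos : ∀ t ∈ Ioo 0 (π / 2), HasDerivAt (fun t => u (c t)) (z (c t)) t := fun t ht => by
    rw [hcid t (Ioo_subset_Icc_self ht)]
    exact (H.u_deriv t ht).congr_of_eventuallyEq ((hin t ht).mono fun q hq => congrArg u hq)
  have hneg : ∀ t < 0, HasDerivAt (fun t => u (c t)) (z (c t)) t := fun t ht => by
    have hc0 : ∀ q < 0, c q = 0 := fun q hq => max_eq_left ((min_le_left _ _).trans hq.le)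
    rw [hc0 t ht, hz0]
    refine (hasDerivAt_const t (u 0)).congr_of_eventuallyEq ?_
    filter_upwards [Iio_mem_nhds ht] with q hq
    rw [hc0 q hq]
  refine ⟨fun t => u (c t), fun t => z (c t), hUc, hZc, fun t ht => ?_, fun t ht => ?_,
    fun t ht => congrArg u (hcid t ht), ?_, ?_⟩
  · rcases lt_trichotomy t 0 with h | h | h
    · exact hneg t h
    · refine hasDerivAt_of_eventually_hasDerivAt (g := fun t => z (c t)) ?_ hUc.continuousAt
        hZc.continuousAt
      filter_upwards [self_mem_nhdsWithin, nhdsWithin_le_nhds (Iio_mem_nhds ht)] with q hq hq'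
      rcases lt_or_gt_of_ne (show q ≠ 0 by rw [← h]; exact hq) with h' | h'
      · exact hneg q h'
      · exact hpos q ⟨h', hq'⟩
    · exact hpos t ⟨h, ht⟩
  · simp only [hcid t (Ioo_subset_Icc_self ht)]
    exact (H.hasDerivAt_deriv ht).congr_of_eventuallyEq
      ((hin t ht).mono fun q hq => congrArg z hq)
  · exact (congrArg z (hcid 0 ⟨le_rfl, hle⟩)).trans hz0
  · exact (congrArg z (hcid _ ⟨hle, le_rfl⟩)).trans (by simp [hz])

/-- Two radial solutions on the hemisphere with matching Cauchy data at the equator glue to a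
solution on the sphere. -/
theorem exists_isYamabeSolution {d : ℕ} (hd : d ≠ 0) {p lam : ℝ} (hp : 2 < p)
    {u v w y : ℝ → ℝ} (H : IsRadialSol d (fun t => yamabeForce p lam (u t)) u v)
    (H' : IsRadialSol d (fun t => yamabeForce p lam (w t)) w y)
    (hu : ∀ t ∈ Icc 0 (π / 2), 0 < u t) (hw : ∀ t ∈ Icc 0 (π / 2), 0 < w t)
    (huw : u (π / 2) = w (π / 2)) (hvy : v (π / 2) = -y (π / 2)) :
    ∃ G : ℝ → ℝ, IsYamabeSolution (d + 1) p lam G ∧ G 0 = u 0 ∧ deriv G 0 = 0 ∧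
      (∀ t ∈ Icc 0 π, 0 < G t) ∧ deriv G π = 0 ∧ deriv G (π / 2) = v (π / 2) := by
  have hpi := pi_pos
  have hf : Continuous (yamabeForce p lam) := continuous_yamabeForce hp
  have h0mem : (0 : ℝ) ∈ Icc 0 (π / 2) := left_mem_Icc.2 (by positivity)
  have hemem : π / 2 ∈ Icc 0 (π / 2) := right_mem_Icc.2 (by positivity)
  have hcomp : π - π / 2 = π / 2 := by ring
  obtain ⟨U, Z, hU, hZ, hUd, hZd, hUu, hZ0, hZe⟩ := H.exists_extension hd hf
  obtain ⟨U', Z', hU', hZ', hUd', hZd', hUu', hZ0', hZe'⟩ := H'.exists_extension hd hf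
  set G : ℝ → ℝ := fun t => if t ≤ π / 2 then U t else U' (π - t) with hG
  set D : ℝ → ℝ := fun t => if t ≤ π / 2 then Z t else -Z' (π - t) with hD
  have hrefl : Continuous fun t : ℝ => π - t := by fun_prop
  have hGc : Continuous G := by
    refine Continuous.if_le hU (hU'.comp hrefl) continuous_id continuous_const fun t ht => ?_
    rw [show t = π / 2 from ht, hcomp, hUu _ hemem, hUu' _ hemem, huw]
  have hDc : Continuous D := by
    refine Continuous.if_le hZ (hZ'.comp hrefl).neg continuous_id continuous_const fun t ht => ?_
    rw [show t = π / 2 from ht, hcomp, hZe, hZe', hvy]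
  have hGl : ∀ t ≤ π / 2, G t = U t := fun t ht => if_pos ht
  have hGr : ∀ t, π / 2 < t → G t = U' (π - t) := fun t ht => if_neg ht.not_ge
  have hDl : ∀ t ≤ π / 2, D t = Z t := fun t ht => if_pos ht
  have hDr : ∀ t, π / 2 < t → D t = -Z' (π - t) := fun t ht => if_neg ht.not_ge
  have hne : ∀ t, t ≠ π / 2 → HasDerivAt G (D t) t := by
    intro t ht
    rcases lt_or_gt_of_ne ht with h | h
    · rw [hDl t h.le]
      refine (hUd t h).congr_of_eventuallyEq ?_
      filter_upwards [Iio_mem_nhds h] with q hq using hGl q (le_of_lt hq)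
    · rw [hDr t h]
      refine ((hUd' (π - t) (by linarith)).comp_const_sub π t).congr_of_eventuallyEq ?_
      filter_upwards [Ioi_mem_nhds h] with q hq using hGr q hq
  have hGD : ∀ t, HasDerivAt G (D t) t := by
    intro t
    rcases eq_or_ne t (π / 2) with h | h
    · refine hasDerivAt_of_eventually_hasDerivAt ?_ hGc.continuousAt hDc.continuousAt
      filter_upwards [self_mem_nhdsWithin] with q hq
      exact hne q (by rw [← h]; exact hq)
    · exact hne t h
  have hderiv : deriv G = D := funext fun t => (hGD t).deriv
  set Q : ℝ → ℝ := fun t => -yamabeForce p lam (G t) - d * (cos t / sin t) * D t with hQ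
  have hne' : ∀ t ∈ Ioo 0 π, t ≠ π / 2 → HasDerivAt D (Q t) t := by
    intro t ht hte
    rcases lt_or_gt_of_ne hte with h | h
    · simp only [hQ, hDl t h.le, hGl t h.le]
      refine (hZd t ⟨ht.1, h⟩).congr_of_eventuallyEq ?_
      filter_upwards [Iio_mem_nhds h] with q hq using hDl q (le_of_lt hq)
    · simp only [hQ, hDr t h, hGr t h]
      have := ((hZd' (π - t) ⟨by linarith [ht.2], by linarith⟩).comp_const_sub π t).neg
      refine (this.congr_of_eventuallyEq ?_).congr_deriv ?_
      · filter_upwards [Ioi_mem_nhds h] with q hq using hDr q hq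
      · rw [cos_pi_sub, sin_pi_sub]
        ring
  have hDQ : ∀ t ∈ Ioo 0 π, HasDerivAt D (Q t) t := by
    intro t ht
    rcases eq_or_ne t (π / 2) with h | h
    · have hs : sin t ≠ 0 := (sin_pos_of_mem_Ioo ht).ne'
      refine hasDerivAt_of_eventually_hasDerivAt ?_ hDc.continuousAt ?_
      · filter_upwards [self_mem_nhdsWithin, nhdsWithin_le_nhds (Ioo_mem_nhds ht.1 ht.2)]
          with q hq hq'
        exact hne' q hq' (by rw [← h]; exact hq)
      · exact (hf.comp hGc).neg.continuousAt.sub ((continuousAt_const.mul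
          (continuous_cos.continuousAt.div continuous_sin.continuousAt hs)).mul hDc.continuousAt)
    · exact hne' t ht h
  refine ⟨G, ⟨hGc.continuousOn, fun t _ => (hGD t).differentiableAt, fun t ht => ?_,
    fun t ht => ?_⟩, ?_, ?_, fun t ht => ?_, ?_, ?_⟩
  · rw [hderiv]
    exact (hDQ t ht).differentiableAt
  · rw [hderiv, (hDQ t ht).deriv]
    simp only [hQ, yamabeForce]
    push_cast
    ring
  · rw [hGl 0 h0mem.2, hUu 0 h0mem]
  · rw [hderiv, hDl 0 h0mem.2, hZ0]
  · rcases le_or_gt t (π / 2) with h | h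
    · rw [hGl t h, hUu t ⟨ht.1, h⟩]
      exact hu t ⟨ht.1, h⟩
    · have hmem : π - t ∈ Icc 0 (π / 2) := ⟨by linarith [ht.2], by linarith⟩
      rw [hGr t h, hUu' _ hmem]
      exact hw _ hmem
  · rw [hderiv, hDr π (by linarith), sub_self, hZ0', neg_zero]
  · rw [hderiv, hDl _ le_rfl, hZe]

/-- If `2n(2n+m-1) < λ(p-2) ≤ (2n+2)(2n+2+m-1)` with
`p = 2(m+k)/(m+k-2)`, then there are at least `2n+2` initial values `α > 0`
whose solutions of the Yamabe ODE are positive on `[0, π]` with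
`u'(0) = u'(π) = 0`; for at least `2n+1` of them the solution can moreover be
chosen with `u'(π/2) = 0`. -/
theorem number_of_solutions (m k n : ℕ) (hm : 2 ≤ m) (hk : 1 ≤ k)
    (hn : 1 ≤ n) (p lam : ℝ)
    (hp : p = 2 * ((m : ℝ) + (k : ℝ)) / ((m : ℝ) + (k : ℝ) - 2))
    (hlam : 0 < lam)
    (h1 : (2 * (n : ℝ)) * (2 * (n : ℝ) + (m : ℝ) - 1) < lam * (p - 2))
    (h2 : lam * (p - 2) ≤ (2 * (n : ℝ) + 2) * (2 * (n : ℝ) + 2 + (m : ℝ) - 1)) :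
    ∃ S : Finset ℝ, (∀ α ∈ S, 0 < α) ∧ 2 * n + 2 ≤ S.card ∧
      (∀ α ∈ S, ∃ u : ℝ → ℝ, IsYamabeSolution m p lam u ∧
        u 0 = α ∧ deriv u 0 = 0 ∧ (∀ t ∈ Icc (0 : ℝ) π, 0 < u t) ∧
        deriv u π = 0) ∧
      ∃ T ⊆ S, 2 * n + 1 ≤ T.card ∧
        ∀ α ∈ T, ∃ u : ℝ → ℝ, IsYamabeSolution m p lam u ∧
          u 0 = α ∧ deriv u 0 = 0 ∧ (∀ t ∈ Icc (0 : ℝ) π, 0 < u t) ∧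
          deriv u π = 0 ∧ deriv u (π / 2) = 0 := by
  obtain ⟨d, rfl⟩ : ∃ d, m = d + 1 := ⟨m - 1, by omega⟩
  have hd : d ≠ 0 := by omega
  have hd1 : (1 : ℝ) ≤ d := by exact_mod_cast Nat.one_le_iff_ne_zero.2 hd
  have hk1 : (1 : ℝ) ≤ k := by exact_mod_cast hk
  push_cast at hp h1
  have hN : 0 < (d : ℝ) + 1 + k - 2 := by linarith
  have hp2 : p - 2 = 4 / ((d : ℝ) + 1 + k - 2) := by
    rw [hp]
    field_simp
    ring
  have hp' : 2 < p := by
    have : 0 < 4 / ((d : ℝ) + 1 + k - 2) := by positivity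
    linarith
  have hsub : ((d : ℝ) + 1) * (p - 2) < 2 * p := by
    rw [hp2, hp, mul_div_assoc', mul_div_assoc', div_lt_div_iff_of_pos_right hN]
    linarith
  obtain ⟨I, U, V, hI, ⟨T, hT, hTV⟩, α, hα, β, hβ, hx, hy, hy0⟩ :=
    exists_shooting hd hn hp' hlam hsub (by rw [show (2 * n : ℝ) * (2 * n + d)
      = 2 * n * (2 * n + (d + 1) - 1) by ring]; exact h1)
  have hglue : ∀ α ∈ I, ∀ β ∈ I, U α (π / 2) = U β (π / 2) → V α (π / 2) = -V β (π / 2) →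
      ∃ u : ℝ → ℝ, IsYamabeSolution (d + 1) p lam u ∧ u 0 = α ∧ deriv u 0 = 0 ∧
        (∀ t ∈ Icc (0 : ℝ) π, 0 < u t) ∧ deriv u π = 0 ∧ deriv u (π / 2) = V α (π / 2) := by
    intro α hα β hβ hU hV
    obtain ⟨-, H, h0, hpos⟩ := hI α hα
    obtain ⟨-, H', -, hpos'⟩ := hI β hβ
    have := exists_isYamabeSolution hd hp' H H' hpos hpos' hU hV
    rwa [h0] at this
  have hTsol : ∀ α ∈ T, ∃ u : ℝ → ℝ, IsYamabeSolution (d + 1) p lam u ∧ u 0 = α ∧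
      deriv u 0 = 0 ∧ (∀ t ∈ Icc (0 : ℝ) π, 0 < u t) ∧ deriv u π = 0 ∧
      deriv u (π / 2) = 0 := by
    intro α hα
    obtain ⟨hαI, hα0⟩ := hTV α hα
    have := hglue α hαI α hαI rfl (by rw [hα0, neg_zero])
    rwa [hα0] at this
  have hαT : α ∉ T := fun h => hy0 (hTV α h).2
  refine ⟨insert α T, fun γ hγ => ?_, by rw [Finset.card_insert_of_notMem hαT, hT],
    fun γ hγ => ?_, T, Finset.subset_insert _ _, hT.ge, hTsol⟩
  · rcases Finset.mem_insert.1 hγ with rfl | h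
    · exact (hI _ hα).1
    · exact (hI _ (hTV γ h).1).1
  · rcases Finset.mem_insert.1 hγ with rfl | h
    · obtain ⟨u, h₁, h₂, h₃, h₄, h₅, -⟩ := hglue _ hα β hβ hx hy
      exact ⟨u, h₁, h₂, h₃, h₄, h₅⟩
    · obtain ⟨u, h₁, h₂, h₃, h₄, h₅, -⟩ := hTsol γ h
      exact ⟨u, h₁, h₂, h₃, h₄, h₅⟩
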